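/- arXiv:1408.3869 — 2 statements merged into one kernel-verified Lean document; each statement's English description precedes it below -/
import Mathlib

section
/- Let G be a finite graph, W ⊆ V(G), and let s > 0 and 0 < ε < 1/2 be real numbers. If no separation of G is (s, ε)-skewed with respect to W, then G contains an (s, ε)-tame W-cloud. -/
open Finset

universe u

variable {V : Type u} [Fintype V] [DecidableEq V]

/-- `(A, B)` is a separation of the subgraph `H` of `G`: `A ∪ B` is the vertex set of `H`
and no edge of `H` has one end in `A \ B` and the other in `B \ A`.
Its order is `(A ∩ B).card`. -/
def SepOf {G : SimpleGraph V} (H : G.Subgraph) (A B : Finset V) : Prop :=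
  (↑A ∪ ↑B : Set V) = H.verts ∧
    ∀ u v : V, H.Adj u v → ¬(u ∈ A \ B ∧ v ∈ B \ A)

/-- `(A, B)` is a balanced separation of the subgraph `H`:
`|A \ B| ≤ (2/3) |V(H)|` and `|B \ A| ≤ (2/3) |V(H)|`. -/
def BalancedSepOf {G : SimpleGraph V} (H : G.Subgraph) (A B : Finset V) : Prop :=
  SepOf H A B ∧ 3 * (A \ B).card ≤ 2 * H.verts.ncard ∧ 3 * (B \ A).card ≤ 2 * H.verts.ncard

/-- `(A, B)` is an `(s, ε)`-skewed separation of `H` with respect to `W`: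
`W ⊆ A`, `|A| ≤ 6s` and `|A ∩ B| ≤ 6ε|W|`. -/
def SkewedSepOf {G : SimpleGraph V} (H : G.Subgraph) (W A B : Finset V) (s ε : ℝ) : Prop :=
  SepOf H A B ∧ W ⊆ A ∧ (A.card : ℝ) ≤ 6 * s ∧ ((A ∩ B).card : ℝ) ≤ 6 * ε * (W.card : ℝ)

/-- `u` and `v` both belong to the subgraph `H` and are connected in `H`. -/
def CReach {G : SimpleGraph V} (H : G.Subgraph) (u v : V) : Prop :=
  ∃ (hu : u ∈ H.verts) (hv : v ∈ H.verts), H.coe.Reachable ⟨u, hu⟩ ⟨v, hv⟩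

/-- The vertex set of the connected component `H_w` of `H` containing `w`. -/
def cloudComp {G : SimpleGraph V} (H : G.Subgraph) (w : V) : Set V :=
  {v | CReach H w v}

/-- `n(H, U) = Σ_{w ∈ U} |V(H_w)|`. -/
noncomputable def cloudSize {G : SimpleGraph V} (H : G.Subgraph) (U : Finset V) : ℕ :=
  ∑ w ∈ U, (cloudComp H w).ncard

/-- `H` is a `W`-cloud in `G`: a forest subgraph of `G` in which every connected
component contains exactly one vertex of `W`. -/
def IsCloud (G : SimpleGraph V) (W : Finset V) (H : G.Subgraph) : Prop :=
  H.coe.IsAcyclic ∧ (↑W : Set V) ⊆ H.verts ∧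
    ∀ v ∈ H.verts, ∃! w, w ∈ W ∧ CReach H v w

/-- `H` is an `(s, ε)`-tame `W`-cloud: `n(H, U) ≥ s` for every `U ⊆ W` with
`|U| ≥ (1 - ε)|W|`. -/
def IsTameCloud (G : SimpleGraph V) (W : Finset V) (H : G.Subgraph) (s ε : ℝ) : Prop :=
  IsCloud G W H ∧
    ∀ U ⊆ W, (1 - ε) * (W.card : ℝ) ≤ (U.card : ℝ) → s ≤ (cloudSize H U : ℝ)

set_option linter.unusedSectionVars false

/-- The graph whose edges are the edges of `G` joining two vertices with the same root under the
partial assignment `r` of roots. -/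
def rootGraph (G : SimpleGraph V) (r : V → Option V) : SimpleGraph V where
  Adj u v := G.Adj u v ∧ r u = r v ∧ r u ≠ none
  symm := ⟨fun _ _ h => ⟨h.1.symm, h.2.1.symm, h.2.1 ▸ h.2.2⟩⟩
  loopless := ⟨fun _ h => h.1.ne rfl⟩

/-- A partial assignment of roots in `W` to vertices, such that each vertex with a root is
connected to it through vertices with the same root. -/
structure IsRootMap (G : SimpleGraph V) (W : Finset V) (r : V → Option V) : Prop where
  root : ∀ w ∈ W, r w = some w
  mem : ∀ x t, r x = some t → t ∈ W
  reachable : ∀ x t, r x = some t → (rootGraph G r).Reachable x t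

/-- The set of vertices with root `t`. -/
def rootClass (r : V → Option V) (t : V) : Finset V := {x | r x = some t}

lemma rootGraph_reachable_eq {G : SimpleGraph V} {r : V → Option V} {u v : V}
    (h : (rootGraph G r).Reachable u v) : r u = r v := by
  rw [SimpleGraph.reachable_iff_reflTransGen] at h
  induction h with
  | refl => rfl
  | tail _ h ih => exact ih.trans h.2.1

lemma IsRootMap.exists_isCloud {G : SimpleGraph V} {W : Finset V} {r : V → Option V}
    (hr : IsRootMap G W r) : ∃ H : G.Subgraph, IsCloud G W H ∧
      ∀ w ∈ W, (cloudComp H w).ncard = (rootClass r w).card := by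
  obtain ⟨F, hF, hac, hreach⟩ := (rootGraph G r).exists_isAcyclic_reachable_eq_le
  let H : G.Subgraph :=
    { verts := {v | r v ≠ none}
      Adj := F.Adj
      adj_sub := fun h => (hF h).1
      edge_vert := fun h => (hF h).2.2
      symm := F.symm }
  have reach_iff : ∀ u v, r u ≠ none → (CReach H u v ↔ (rootGraph G r).Reachable u v) := by
    intro u v hu
    constructor
    · rintro ⟨hu, hv, h⟩
      rw [← hreach]
      exact h.map (⟨Subtype.val, fun h => h⟩ : H.coe →g F)
    · intro h
      rw [← hreach, SimpleGraph.reachable_iff_reflTransGen] at h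
      induction h with
      | refl => exact ⟨hu, hu, SimpleGraph.Reachable.refl _⟩
      | tail _ h ih =>
        obtain ⟨h1, h2, h3⟩ := ih
        exact ⟨h1, H.edge_vert (F.symm.symm _ _ h), h3.trans
          (SimpleGraph.Adj.reachable (G := H.coe) (by exact h))⟩
  refine ⟨H, ⟨?_, ?_, ?_⟩, ?_⟩
  · exact hac.comap (⟨Subtype.val, fun h => h⟩ : H.coe →g F) Subtype.val_injective
  · intro w hw
    simp [H, hr.root w hw]
  · intro v hv
    obtain ⟨t, ht⟩ := Option.ne_none_iff_exists'.1 hv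
    refine ⟨t, ⟨hr.mem v t ht, (reach_iff v t hv).2 (hr.reachable v t ht)⟩, ?_⟩
    rintro w ⟨hw, hvw⟩
    have := rootGraph_reachable_eq ((reach_iff v w hv).1 hvw)
    rw [ht, hr.root w hw] at this
    exact (Option.some.inj this).symm
  · intro w hw
    have hw' := hr.root w hw
    rw [← Set.ncard_coe_finset]
    congr 1
    ext x
    simp only [cloudComp, Set.mem_ofPred_eq, rootClass, coe_filter, mem_univ, true_and]
    rw [reach_iff w x (by simp [hw'])]
    constructor
    · intro h
      rw [← rootGraph_reachable_eq h, hw']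
    · intro h
      exact (hr.reachable x w h).symm

lemma IsRootMap.update {G : SimpleGraph V} {W : Finset V} {r : V → Option V}
    (hr : IsRootMap G W r) {u x t : V} (hu : r u = none) (hx : r x = some t) (h : G.Adj u x) :
    IsRootMap G W (Function.update r u (some t)) := by
  have hne : ∀ {y s}, r y = some s → y ≠ u := by
    rintro y s hy rfl
    simp [hu] at hy
  have hle : rootGraph G r ≤ rootGraph G (Function.update r u (some t)) := by
    intro a b hab
    have ha : a ≠ u := fun h => hab.2.2 (h ▸ hu)
    have hb : b ≠ u := fun h => hab.2.2 (hab.2.1.trans (h ▸ hu))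
    refine ⟨hab.1, ?_⟩
    simpa [Function.update_of_ne ha, Function.update_of_ne hb] using hab.2
  refine ⟨fun w hw => ?_, fun y s hy => ?_, fun y s hy => ?_⟩
  · rw [Function.update_of_ne (hne (hr.root w hw)), hr.root w hw]
  · by_cases hyu : y = u
    · subst hyu
      simp only [Function.update_self, Option.some.injEq] at hy
      exact hy ▸ hr.mem x t hx
    · rw [Function.update_of_ne hyu] at hy
      exact hr.mem y s hy
  · by_cases hyu : y = u
    · subst hyu
      simp only [Function.update_self, Option.some.injEq] at hy
      subst hy
      refine SimpleGraph.Reachable.trans (SimpleGraph.Adj.reachable ?_)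
        ((hr.reachable x t hx).mono hle)
      refine ⟨h, ?_⟩
      simp [Function.update_of_ne (hne hx), hx]
    · rw [Function.update_of_ne hyu] at hy
      exact (hr.reachable y s hy).mono hle

/-- The total flow leaving `x`. -/
def outflow (f : V → V → ℝ) (x : V) : ℝ := ∑ v, f x v

/-- The total flow entering `x`. -/
def inflow (f : V → V → ℝ) (x : V) : ℝ := ∑ u, f u x

lemma sum_outflow_eq_sum_inflow (f : V → V → ℝ) : ∑ x, outflow f x = ∑ x, inflow f x :=
  Finset.sum_comm

lemma outflow_add_mul (f g : V → V → ℝ) (δ : ℝ) (x : V) :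
    outflow (fun u v => f u v + δ * g u v) x = outflow f x + δ * outflow g x := by
  simp [outflow, Finset.sum_add_distrib, Finset.mul_sum]

lemma inflow_add_mul (f g : V → V → ℝ) (δ : ℝ) (x : V) :
    inflow (fun u v => f u v + δ * g u v) x = inflow f x + δ * inflow g x := by
  simp [inflow, Finset.sum_add_distrib, Finset.mul_sum]

/-- The unit flow on the single arc `(a, b)`. -/
def arcFlow (a b u v : V) : ℝ := if u = a ∧ v = b then 1 else 0

lemma outflow_arcFlow (a b x : V) : outflow (arcFlow a b) x = if x = a then 1 else 0 := by
  by_cases h : x = a <;> simp [outflow, arcFlow, h]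

lemma inflow_arcFlow (a b x : V) : inflow (arcFlow a b) x = if x = b then 1 else 0 := by
  by_cases h : x = b <;> simp [inflow, arcFlow, h]

lemma arcFlow_nonneg (a b u v : V) : 0 ≤ arcFlow a b u v := by
  unfold arcFlow; split_ifs <;> simp

lemma arcFlow_ne_zero {a b u v : V} (h : arcFlow a b u v ≠ 0) : u = a ∧ v = b := by
  by_contra h'
  exact h (if_neg h')

/-- If `v` reaches `t` along arcs in the support of `f`, a unit of flow may be sent from `v` to `t`
within this support. -/
lemma exists_unit_flow_of_reflTransGen {f : V → V → ℝ} {v t : V}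
    (h : Relation.ReflTransGen (fun a b => f a b ≠ 0) v t) :
    ∃ P : V → V → ℝ, (∀ a b, 0 ≤ P a b) ∧ (∀ a b, P a b ≠ 0 → f a b ≠ 0) ∧
      ∀ x, outflow P x + (if x = t then 1 else 0) = inflow P x + (if x = v then 1 else 0) := by
  induction h using Relation.ReflTransGen.head_induction_on with
  | refl => exact ⟨fun _ _ => 0, by simp, by simp, by simp [outflow, inflow]⟩
  | @head a b hab _ ih =>
    obtain ⟨P, hP0, hP, hcons⟩ := ih
    refine ⟨fun u v => P u v + 1 * arcFlow a b u v, fun u v => ?_, fun u v huv => ?_, fun x => ?_⟩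
    · have := arcFlow_nonneg a b u v
      have := hP0 u v
      linarith
    · by_cases h : arcFlow a b u v = 0
      · exact hP u v (by simpa [h] using huv)
      · obtain ⟨rfl, rfl⟩ := arcFlow_ne_zero h
        exact hab
    · rw [outflow_add_mul, inflow_add_mul, outflow_arcFlow, inflow_arcFlow]
      linarith [hcons x]

/-- Moving a nonnegative vector in a direction supported on its support and with a negative
coordinate, until the first coordinate vanishes. -/
lemma exists_pos_add_mul_eq_zero {ι : Type*} [Fintype ι] {f d : ι → ℝ} (hf : ∀ i, 0 ≤ f i)
    (hd : ∀ i, d i ≠ 0 → f i ≠ 0) (hneg : ∃ i, d i < 0) :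
    ∃ δ > 0, (∀ i, 0 ≤ f i + δ * d i) ∧ ∃ i, f i ≠ 0 ∧ f i + δ * d i = 0 := by
  classical
  obtain ⟨i₀, hi₀⟩ := hneg
  obtain ⟨i, hi, hmin⟩ := Finset.exists_min_image ({i | d i < 0} : Finset ι)
    (fun i => f i / -d i) ⟨i₀, by simpa using hi₀⟩
  simp only [mem_filter, mem_univ, true_and] at hi hmin
  have hfi : 0 < f i := lt_of_le_of_ne (hf i) (hd i hi.ne).symm
  have hδ : 0 < f i / -d i := div_pos hfi (by linarith)
  refine ⟨f i / -d i, hδ, fun j => ?_, i, hfi.ne', ?_⟩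
  · by_cases hj : d j < 0
    · have := (le_div_iff₀ (by linarith : 0 < -d j)).1 (hmin j hj)
      linarith
    · have := mul_nonneg hδ.le (not_lt.1 hj)
      linarith [hf j]
  · have hi' := hi.ne
    field_simp
    ring

/-- The support of a flow. -/
noncomputable def flowSupport (f : V → V → ℝ) : Finset (V × V) := {e | f e.1 e.2 ≠ 0}

lemma card_flowSupport_lt {f g : V → V → ℝ} (h : ∀ u v, g u v ≠ 0 → f u v ≠ 0) {a b : V}
    (hf : f a b ≠ 0) (hg : g a b = 0) : (flowSupport g).card < (flowSupport f).card := by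
  refine Finset.card_lt_card ⟨fun e he => ?_, fun hle => ?_⟩
  · simp only [flowSupport, mem_filter, mem_univ, true_and] at he ⊢
    exact h _ _ he
  · have : (a, b) ∈ flowSupport f := by simpa [flowSupport] using hf
    simpa [flowSupport, hg] using hle this

/-- A flow towards the roots `W`: vertices with a root under `r` have been contracted to it, every
other vertex emits at most one unit of its own, and all throughputs are at most `c`. -/
structure RootFlow (G : SimpleGraph V) (W : Finset V) (c : ℝ) (r : V → Option V)
    (f : V → V → ℝ) : Prop where
  isRootMap : IsRootMap G W r
  nonneg : ∀ u v, 0 ≤ f u v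
  tail : ∀ u v, f u v ≠ 0 → r u = none
  head : ∀ u v, f u v ≠ 0 →
    (r v = none ∧ G.Adj u v) ∨ (v ∈ W ∧ ∃ x, r x = some v ∧ G.Adj u x)
  outflow_le_one_add : ∀ u, r u = none → outflow f u ≤ 1 + inflow f u
  outflow_le : ∀ u, outflow f u ≤ c
  inflow_le : ∀ t ∈ W, inflow f t ≤ c

/-- The value of a flow: twice a lower bound for the total size of root classes, capped at `c`,
obtained by rounding it. -/
noncomputable def rootValue (W : Finset V) (c : ℝ) (r : V → Option V) (f : V → V → ℝ) : ℝ :=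
  ∑ t ∈ W, if ((rootClass r t).card : ℝ) < c then (rootClass r t).card + inflow f t else 2 * c

section RootFlow

variable {G : SimpleGraph V} {W : Finset V} {c : ℝ} {r : V → Option V} {f g : V → V → ℝ}

lemma outflow_nonneg (hf : ∀ u v, 0 ≤ f u v) (x : V) : 0 ≤ outflow f x :=
  Finset.sum_nonneg fun _ _ => hf _ _

lemma inflow_nonneg (hf : ∀ u v, 0 ≤ f u v) (x : V) : 0 ≤ inflow f x :=
  Finset.sum_nonneg fun _ _ => hf _ _

lemma RootFlow.ne_none (hf : RootFlow G W c r f) {t : V} (ht : t ∈ W) : r t ≠ none := by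
  simp [hf.isRootMap.root t ht]

lemma RootFlow.eq_zero_of_mem (hf : RootFlow G W c r f) {t : V} (ht : t ∈ W) (v : V) :
    f t v = 0 := by
  by_contra h
  exact hf.ne_none ht (hf.tail t v h)

/-- Restricting the flow to smaller arc values. -/
lemma RootFlow.of_le (hf : RootFlow G W c r f) (hg0 : ∀ u v, 0 ≤ g u v) (hgf : ∀ u v, g u v ≤ f u v)
    (hcons : ∀ u, r u = none → outflow g u ≤ 1 + inflow g u) : RootFlow G W c r g := by
  have hne : ∀ u v, g u v ≠ 0 → f u v ≠ 0 := fun u v h h' =>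
    h (le_antisymm (h' ▸ hgf u v) (hg0 u v))
  exact ⟨hf.isRootMap, hg0, fun u v h => hf.tail u v (hne u v h),
    fun u v h => hf.head u v (hne u v h), hcons,
    fun u => (Finset.sum_le_sum fun v _ => hgf u v).trans (hf.outflow_le u),
    fun t ht => (Finset.sum_le_sum fun u _ => hgf u t).trans (hf.inflow_le t ht)⟩

/-- Discarding the flow into a root whose class is already large. -/
lemma RootFlow.delete_root (hf : RootFlow G W c r f) {t u : V} (ht : t ∈ W) (hut : f u t ≠ 0)
    (hc : c ≤ (rootClass r t).card) :
    ∃ g, RootFlow G W c r g ∧ rootValue W c r f ≤ rootValue W c r g ∧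
      (flowSupport g).card < (flowSupport f).card := by
  let g : V → V → ℝ := fun u v => if v = t then 0 else f u v
  have hin : ∀ x, x ≠ t → inflow g x = inflow f x := fun x hx => by simp [inflow, g, hx]
  have hgf : ∀ u v, g u v ≤ f u v := fun u v => by
    simp only [g]; split_ifs; exacts [hf.nonneg u v, le_rfl]
  refine ⟨g, hf.of_le (fun u v => ?_) hgf fun x hx => ?_, ?_, ?_⟩
  · simp only [g]; split_ifs; exacts [le_rfl, hf.nonneg u v]
  · rw [hin x (by rintro rfl; exact hf.ne_none ht hx)]
    exact (Finset.sum_le_sum fun v _ => hgf x v).trans (hf.outflow_le_one_add x hx)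
  · refine Finset.sum_le_sum fun s _ => ?_
    by_cases hs : s = t
    · subst hs
      simp [not_lt.2 hc]
    · rw [hin s hs]
  · refine card_flowSupport_lt (fun u v h => ?_) hut (by simp [g])
    simp only [g] at h
    split_ifs at h
    exacts [absurd rfl h, h]

/-- Discarding the flow that never arrives at a root. -/
lemma RootFlow.delete_unreaching (hf : RootFlow G W c r f) {u v : V} (huv : f u v ≠ 0)
    (hv : ∀ t ∈ W, ¬ Relation.ReflTransGen (fun a b => f a b ≠ 0) v t) :
    ∃ g, RootFlow G W c r g ∧ rootValue W c r f ≤ rootValue W c r g ∧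
      (flowSupport g).card < (flowSupport f).card := by
  classical
  let Q : V → Prop := fun v => ∀ t ∈ W, ¬ Relation.ReflTransGen (fun a b => f a b ≠ 0) v t
  have hQ : ∀ x y, Q x → f x y ≠ 0 → Q y := fun x y hx hxy t ht h =>
    hx t ht (Relation.ReflTransGen.head hxy h)
  let g : V → V → ℝ := fun u v => if Q v then 0 else f u v
  have hin : ∀ x, ¬ Q x → inflow g x = inflow f x := fun x hx => by simp [inflow, g, hx]
  have hg0 : ∀ u v, 0 ≤ g u v := fun u v => by
    simp only [g]; split_ifs; exacts [le_rfl, hf.nonneg u v]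
  have hgf : ∀ u v, g u v ≤ f u v := fun u v => by
    simp only [g]; split_ifs; exacts [hf.nonneg u v, le_rfl]
  refine ⟨g, hf.of_le hg0 hgf fun x hx => ?_, ?_, ?_⟩
  · by_cases hxQ : Q x
    · have h0 : outflow g x = 0 := by
        refine Finset.sum_eq_zero fun y _ => ?_
        simp only [g]
        split_ifs with hy
        · rfl
        · by_contra h
          exact hy (hQ x y hxQ h)
      linarith [inflow_nonneg hg0 x]
    · rw [hin x hxQ]
      exact (Finset.sum_le_sum fun v _ => hgf x v).trans (hf.outflow_le_one_add x hx)
  · refine Finset.sum_le_sum fun s hs => ?_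
    rw [hin s fun h => h s hs .refl]
  · refine card_flowSupport_lt (fun u v h => ?_) huv (if_pos hv)
    simp only [g] at h
    split_ifs at h
    exacts [absurd rfl h, h]

/-- Contracting a vertex all of whose outgoing flow enters a single root. -/
lemma RootFlow.contract (hf : RootFlow G W c r f) {t u : V} (ht : t ∈ W) (hut : f u t ≠ 0)
    (honly : ∀ v, v ≠ t → f u v = 0) (hc : ((rootClass r t).card : ℝ) < c) :
    ∃ g, RootFlow G W c (Function.update r u (some t)) g ∧
      rootValue W c r f ≤ rootValue W c (Function.update r u (some t)) g := by
  have hu : r u = none := hf.tail u t hut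
  have htu : t ≠ u := by rintro rfl; exact hf.ne_none ht hu
  obtain ⟨x, hx, hux⟩ : ∃ x, r x = some t ∧ G.Adj u x := by
    rcases hf.head u t hut with h | h
    exacts [absurd h.1 (hf.ne_none ht), h.2]
  have hroot := hf.isRootMap.update hu hx hux
  have hout : outflow f u = f u t :=
    Finset.sum_eq_single t (fun v _ hv => honly v hv) (by simp)
  have huu : f u u = 0 := honly u htu.symm
  have hin0 := inflow_nonneg hf.nonneg u
  obtain ⟨κ, hκ0, hκ1, hκ, hκ'⟩ : ∃ κ : ℝ, 0 ≤ κ ∧ κ ≤ 1 ∧ κ * inflow f u ≤ f u t ∧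
      f u t ≤ 1 + κ * inflow f u := by
    have h1 := hf.outflow_le_one_add u hu
    rw [hout] at h1
    by_cases h : inflow f u ≤ f u t
    · exact ⟨1, by simp, le_rfl, by simpa using h, by simpa using h1⟩
    · have hpos : 0 < inflow f u := lt_of_le_of_lt (hf.nonneg u t) (not_le.1 h)
      refine ⟨f u t / inflow f u, div_nonneg (hf.nonneg _ _) hpos.le,
        (div_le_one hpos).2 (not_le.1 h).le, ?_⟩
      rw [div_mul_cancel₀ _ hpos.ne']
      exact ⟨le_rfl, by linarith⟩
  let g : V → V → ℝ := fun a b =>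
    if a = u then 0 else (if b = u then 0 else f a b) + if b = t then κ * f a u else 0
  have hg0 : ∀ a b, 0 ≤ g a b := fun a b => by
    have := hf.nonneg a b
    have := mul_nonneg hκ0 (hf.nonneg a u)
    simp only [g]
    split_ifs <;> simp <;> linarith
  have hr' : ∀ y, y ≠ u → Function.update r u (some t) y = r y := fun y hy =>
    Function.update_of_ne hy _ _
  have hsome : ∀ y s, r y = some s → Function.update r u (some t) y = some s := by
    intro y s hy
    rw [hr' y (by rintro rfl; simp [hu] at hy), hy]
  have hgout : ∀ y, outflow g y ≤ outflow f y := by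
    intro y
    by_cases hy : y = u
    · simpa [outflow, g, hy] using outflow_nonneg hf.nonneg u
    · have : outflow g y = outflow f y - f y u + κ * f y u := by
        simp only [outflow, g, hy, if_false, Finset.sum_add_distrib, Finset.sum_ite_eq', mem_univ,
          if_true]
        congr 1
        rw [eq_sub_iff_add_eq, ← Finset.add_sum_erase _ _ (mem_univ u), if_pos rfl, zero_add,
          ← Finset.add_sum_erase univ (fun v => f y v) (mem_univ u), add_comm]
        congr 1
        exact Finset.sum_congr rfl fun v hv => if_neg (Finset.ne_of_mem_erase hv)
      have := mul_le_mul_of_nonneg_right hκ1 (hf.nonneg y u)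
      linarith
  have hgin : ∀ y, y ≠ u → y ≠ t → inflow g y = inflow f y := by
    intro y hyu hyt
    refine Finset.sum_congr rfl fun a _ => ?_
    by_cases ha : a = u
    · simp [g, ha, honly y hyt]
    · simp [g, ha, hyu, hyt]
  have hgt : inflow g t = inflow f t - f u t + κ * inflow f u := by
    have h1 : ∀ a, g a t = f a t - (if a = u then f u t else 0) + κ * f a u := by
      intro a
      by_cases ha : a = u
      · simp [g, ha, huu]
      · simp [g, ha, htu]
    simp only [inflow, h1, Finset.sum_add_distrib, Finset.sum_sub_distrib, Finset.mul_sum,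
      Finset.sum_ite_eq', mem_univ, if_true]
  have hclass : rootClass (Function.update r u (some t)) t = insert u (rootClass r t) := by
    ext y
    by_cases hy : y = u
    · simp [rootClass, hy]
    · simp [rootClass, hy]
  have hcard : (rootClass (Function.update r u (some t)) t).card = (rootClass r t).card + 1 := by
    rw [hclass, Finset.card_insert_of_notMem (by simp [rootClass, hu])]
  have hclass' : ∀ s, s ≠ t →
      rootClass (Function.update r u (some t)) s = rootClass r s := by
    intro s hs
    ext y
    by_cases hy : y = u
    · simp [rootClass, hy, hu, hs.symm]
    · simp [rootClass, hy]
  refine ⟨g, ⟨hroot, hg0, fun a b hab => ?_, fun a b hab => ?_, fun y hy => ?_,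
    fun y => (hgout y).trans (hf.outflow_le y), fun s hs => ?_⟩, ?_⟩
  · have ha : a ≠ u := by rintro rfl; simp [g] at hab
    rw [hr' a ha]
    by_contra hra
    have h0 : ∀ b, f a b = 0 := fun b => by
      by_contra h
      exact hra (hf.tail a b h)
    simp [g, h0] at hab
  · have ha : a ≠ u := by rintro rfl; simp [g] at hab
    by_cases hfa : b ≠ u ∧ f a b ≠ 0
    · rw [hr' b hfa.1]
      rcases hf.head a b hfa.2 with h | ⟨h, y, hy, hay⟩
      exacts [.inl h, .inr ⟨h, y, hsome y b hy, hay⟩]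
    · have hb : b = t := by
        by_contra hb
        by_cases hbu : b = u
        · simp [g, hbu] at hab
          exact htu hab.2.1.symm
        · exact hab (by simpa [g, ha, hb, hbu] using hfa)
      subst hb
      have h1 : f a u ≠ 0 := by
        intro h
        have h2 : f a b = 0 := by
          by_contra h2
          exact hfa ⟨htu, h2⟩
        simp [g, h, h2] at hab
      refine .inr ⟨ht, u, by simp, ?_⟩
      rcases hf.head a u h1 with h | h
      exacts [h.2, absurd hu (hf.ne_none h.1)]
  · have hyu : y ≠ u := by rintro rfl; simp at hy
    rw [hr' y hyu] at hy
    have hyt : y ≠ t := by rintro rfl; exact hf.ne_none ht hy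
    rw [hgin y hyu hyt]
    exact (hgout y).trans (hf.outflow_le_one_add y hy)
  · by_cases hst : s = t
    · subst hst
      linarith [hf.inflow_le s hs]
    · rw [hgin s (by rintro rfl; exact hf.ne_none hs hu) hst]
      exact hf.inflow_le s hs
  · refine Finset.sum_le_sum fun s hs => ?_
    by_cases hst : s = t
    · subst hst
      rw [if_pos hc, hcard, hgt]
      have := hf.inflow_le s hs
      split_ifs
      · push_cast
        linarith
      · linarith
    · rw [hclass' s hst, hgin s (by rintro rfl; exact hf.ne_none hs hu) hst]

/-- Shifting flow in a direction `D` that only uses arcs in the support, preserves conservation,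
and keeps the total flow into the roots. -/
lemma RootFlow.shift (hf : RootFlow G W c r f) {D : V → V → ℝ}
    (hclosed : ∀ t ∈ W, c ≤ (rootClass r t).card → ∀ u, f u t = 0)
    (hD : ∀ u v, D u v ≠ 0 → f u v ≠ 0) (hneg : ∃ u v, D u v < 0)
    (hcons : ∀ x, r x = none → outflow D x = inflow D x)
    (hle : ∀ x, r x = none → outflow D x ≤ 0)
    (hsum : ∑ t ∈ W, inflow D t = 0)
    (hcap : ∀ t ∈ W, inflow D t ≤ 0 ∨ ∃ v, ∀ u, f u t ≠ 0 → u = v) :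
    ∃ g, RootFlow G W c r g ∧ rootValue W c r f ≤ rootValue W c r g ∧
      (flowSupport g).card < (flowSupport f).card := by
  obtain ⟨a, b, hab⟩ := hneg
  obtain ⟨δ, hδ, hg0, ⟨p, q⟩, hpq, hpq'⟩ := exists_pos_add_mul_eq_zero
    (f := fun e : V × V => f e.1 e.2) (d := fun e : V × V => D e.1 e.2)
    (fun e => hf.nonneg _ _) (fun e => hD _ _) ⟨(a, b), hab⟩
  let g : V → V → ℝ := fun u v => f u v + δ * D u v
  have hgf : ∀ u v, g u v ≠ 0 → f u v ≠ 0 := by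
    intro u v h h'
    have : D u v = 0 := by
      by_contra hne
      exact hD u v hne h'
    simp [g, h', this] at h
  have hout : ∀ x, outflow g x ≤ c := by
    intro x
    rw [outflow_add_mul]
    by_cases hx : r x = none
    · have := mul_nonpos_of_nonneg_of_nonpos hδ.le (hle x hx)
      linarith [hf.outflow_le x]
    · have : outflow D x = 0 := Finset.sum_eq_zero fun v _ => by
        by_contra h
        exact hx (hf.tail x v (hD x v h))
      simpa [this] using hf.outflow_le x
  refine ⟨g, ⟨hf.isRootMap, fun u v => hg0 (u, v), fun u v h => hf.tail u v (hgf u v h),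
    fun u v h => hf.head u v (hgf u v h), fun x hx => ?_, hout,
    fun t ht => ?_⟩, ?_, card_flowSupport_lt hgf hpq hpq'⟩
  · rw [outflow_add_mul, inflow_add_mul, hcons x hx]
    linarith [hf.outflow_le_one_add x hx]
  · rcases hcap t ht with h | ⟨v, hv⟩
    · rw [inflow_add_mul]
      have := mul_nonpos_of_nonneg_of_nonpos hδ.le h
      linarith [hf.inflow_le t ht]
    · have : inflow g t = g v t := Finset.sum_eq_single v
        (fun u _ hu => by
          by_contra h
          exact hu (hv u (hgf u t h)))
        (by simp)
      rw [this]
      exact (Finset.single_le_sum (f := fun t => g v t) (fun y _ => hg0 (v, y))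
        (mem_univ t)).trans (hout v)
  · have key : ∀ h : V → V → ℝ, (∀ u v, h u v ≠ 0 → f u v ≠ 0) → rootValue W c r h =
        ∑ t ∈ W, (if ((rootClass r t).card : ℝ) < c then ((rootClass r t).card : ℝ) else 2 * c) +
          ∑ t ∈ W, inflow h t := by
      intro h hh
      rw [← Finset.sum_add_distrib]
      refine Finset.sum_congr rfl fun t ht => ?_
      split_ifs with hlt
      · rfl
      · have : inflow h t = 0 := Finset.sum_eq_zero fun u _ => by
          by_contra hne
          exact hh u t hne (hclosed t ht (not_lt.1 hlt) u)
        rw [this, add_zero]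
    rw [key f fun _ _ h => h, key g hgf]
    have : ∑ t ∈ W, inflow g t = ∑ t ∈ W, inflow f t := by
      simp only [g, inflow_add_mul, Finset.sum_add_distrib, ← Finset.mul_sum, hsum, mul_zero,
        add_zero]
    rw [this]

/-- If all flow can reach a root, a unit of flow may be sent from `u` to a root, with `(u, y)` as
its first arc. -/
lemma exists_unit_flow_to_root
    (hreach : ∀ u v, f u v ≠ 0 → ∃ t ∈ W, Relation.ReflTransGen (fun a b => f a b ≠ 0) v t)
    {u y : V} (huy : f u y ≠ 0) :
    ∃ (P : V → V → ℝ) (s : V), s ∈ W ∧ (∃ a, f a s ≠ 0) ∧ (∀ a b, 0 ≤ P a b) ∧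
      (∀ a b, P a b ≠ 0 → f a b ≠ 0) ∧ 1 ≤ P u y ∧
      ∀ x, outflow P x + (if x = s then 1 else 0) = inflow P x + (if x = u then 1 else 0) := by
  obtain ⟨s, hs, hys⟩ := hreach u y huy
  obtain ⟨P, hP0, hP, hcons⟩ := exists_unit_flow_of_reflTransGen hys
  have hQ : ∀ a b, P a b + 1 * arcFlow u y a b ≠ 0 → f a b ≠ 0 := by
    intro a b hab
    by_cases h : arcFlow u y a b = 0
    · exact hP a b (by simpa [h] using hab)
    · obtain ⟨rfl, rfl⟩ := arcFlow_ne_zero h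
      exact huy
  refine ⟨fun a b => P a b + 1 * arcFlow u y a b, s, hs, ?_, fun a b => ?_, hQ, ?_, fun x => ?_⟩
  · rcases hys.cases_tail with h | ⟨a, -, ha⟩
    exacts [⟨u, h ▸ huy⟩, ⟨a, ha⟩]
  · have := arcFlow_nonneg u y a b
    have := hP0 a b
    linarith
  · have := hP0 u y
    simp [arcFlow]
    linarith
  · rw [outflow_add_mul, inflow_add_mul, outflow_arcFlow, inflow_arcFlow]
    linarith [hcons x]

/-- If a root `t` receives flow from a single vertex `v`, more of the flow through `v` can be sent
directly to `t`. -/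
lemma RootFlow.shift_of_unique (hf : RootFlow G W c r f)
    (hclosed : ∀ t ∈ W, c ≤ (rootClass r t).card → ∀ u, f u t = 0)
    (hreach : ∀ u v, f u v ≠ 0 → ∃ t ∈ W, Relation.ReflTransGen (fun a b => f a b ≠ 0) v t)
    {t v y : V} (ht : t ∈ W) (hvt : f v t ≠ 0) (huniq : ∀ u, f u t ≠ 0 → u = v)
    (hvy : f v y ≠ 0) (hyt : y ≠ t) :
    ∃ g, RootFlow G W c r g ∧ rootValue W c r f ≤ rootValue W c r g ∧
      (flowSupport g).card < (flowSupport f).card := by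
  obtain ⟨P, s, hs, -, hP0, hP, hP1, hcons⟩ := exists_unit_flow_to_root hreach hvy
  have hroot : ∀ {x s}, s ∈ W → r x = none → x ≠ s := by
    rintro x s hs hx rfl
    exact hf.ne_none hs hx
  refine hf.shift (D := fun a b => arcFlow v t a b + (-1) * P a b) hclosed (fun a b hab => ?_)
    ⟨v, y, ?_⟩ (fun x hx => ?_) (fun x hx => ?_) ?_ fun s' hs' => ?_
  · by_cases h : arcFlow v t a b = 0
    · exact hP a b fun h' => hab (by simp [h, h'])
    · obtain ⟨rfl, rfl⟩ := arcFlow_ne_zero h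
      exact hvt
  · simp only [arcFlow, hyt, and_false, if_false]
    linarith
  · have := hcons x
    rw [outflow_add_mul, inflow_add_mul, outflow_arcFlow, inflow_arcFlow]
    rw [if_neg (hroot hs hx)] at this
    rw [if_neg (hroot ht hx)]
    linarith
  · have := hcons x
    rw [outflow_add_mul, outflow_arcFlow]
    rw [if_neg (hroot hs hx)] at this
    linarith [inflow_nonneg hP0 x]
  · have h1 : ∀ x ∈ W, inflow (fun a b => arcFlow v t a b + (-1) * P a b) x =
        (if x = t then 1 else 0) - if x = s then 1 else 0 := by
      intro x hx
      have h2 := hcons x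
      have h3 : outflow P x = 0 := Finset.sum_eq_zero fun b _ => by
        by_contra h
        exact hP x b h (hf.eq_zero_of_mem hx b)
      rw [if_neg (hroot hx (hf.tail v t hvt)).symm, h3] at h2
      rw [inflow_add_mul, inflow_arcFlow]
      linarith
    rw [Finset.sum_congr rfl h1, Finset.sum_sub_distrib]
    simp [ht, hs]
  · by_cases h : s' = t
    · exact .inr ⟨v, h ▸ huniq⟩
    · left
      rw [inflow_add_mul, inflow_arcFlow, if_neg h]
      linarith [inflow_nonneg hP0 s']

/-- If every vertex sending flow to a root has two outgoing arcs, and every root receiving flow has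
two incoming arcs, then one may choose an arc at each of these, all distinct. -/
lemma exists_distinct_arcs (hout : ∀ t ∈ W, ∀ u, f u t ≠ 0 → ∃ v, v ≠ t ∧ f u v ≠ 0)
    (hin : ∀ t ∈ W, ∀ u, f u t ≠ 0 → ∃ v, v ≠ u ∧ f v t ≠ 0) :
    ∃ o p : V → V, (∀ t ∈ W, ∀ u, f u t ≠ 0 → f u (o u) ≠ 0) ∧
      (∀ t ∈ W, ∀ u, f u t ≠ 0 → f (p t) t ≠ 0) ∧
      ∀ t ∈ W, ∀ u, f u t ≠ 0 → ∀ t' ∈ W, ∀ u', f u' t' ≠ 0 → ¬ (p t' = u ∧ o u = t') := by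
  classical
  let A := {u : V // ∃ t ∈ W, f u t ≠ 0}
  let B := {t : V // t ∈ W ∧ ∃ u, f u t ≠ 0}
  let N : A ⊕ B → Finset (V × V) := Sum.elim
    (fun u => ({e | f e.1 e.2 ≠ 0 ∧ e.1 = u} : Finset (V × V)))
    (fun t => ({e | f e.1 e.2 ≠ 0 ∧ e.2 = t} : Finset (V × V)))
  have hN : ∀ x, 2 ≤ (N x).card := by
    rintro (⟨u, t, ht, hut⟩ | ⟨t, ht, u, hut⟩)
    · obtain ⟨v, hvt, huv⟩ := hout t ht u hut
      exact Finset.one_lt_card.2 ⟨(u, t), by simp [N, hut], (u, v), by simp [N, huv],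
        by simp [hvt.symm]⟩
    · obtain ⟨v, hvu, hvt⟩ := hin t ht u hut
      exact Finset.one_lt_card.2 ⟨(u, t), by simp [N, hut], (v, t), by simp [N, hvt],
        by simp [hvu.symm]⟩
  have hall : ∀ s : Finset (A ⊕ B), s.card ≤ (s.biUnion N).card := by
    intro s
    have hl : 2 * s.toLeft.card ≤ (s.biUnion N).card := by
      calc 2 * s.toLeft.card ≤ ∑ u ∈ s.toLeft, (N (.inl u)).card := by
            rw [mul_comm, ← smul_eq_mul]
            exact Finset.card_nsmul_le_sum _ _ _ fun u _ => hN _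
        _ = (s.toLeft.biUnion fun u => N (.inl u)).card := by
            refine (Finset.card_biUnion fun u _ v _ huv => ?_).symm
            simp only [Function.onFun]
            rw [Finset.disjoint_left]
            intro e he he'
            simp only [N, Sum.elim_inl, mem_filter, mem_univ, true_and] at he he'
            exact huv (Subtype.ext (he.2.symm.trans he'.2))
        _ ≤ _ := by
            refine Finset.card_le_card fun e he => ?_
            obtain ⟨u, hu, he⟩ := Finset.mem_biUnion.1 he
            exact Finset.mem_biUnion.2 ⟨.inl u, Finset.mem_toLeft.1 hu, he⟩
    have hr : 2 * s.toRight.card ≤ (s.biUnion N).card := by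
      calc 2 * s.toRight.card ≤ ∑ u ∈ s.toRight, (N (.inr u)).card := by
            rw [mul_comm, ← smul_eq_mul]
            exact Finset.card_nsmul_le_sum _ _ _ fun u _ => hN _
        _ = (s.toRight.biUnion fun u => N (.inr u)).card := by
            refine (Finset.card_biUnion fun u _ v _ huv => ?_).symm
            simp only [Function.onFun]
            rw [Finset.disjoint_left]
            intro e he he'
            simp only [N, Sum.elim_inr, mem_filter, mem_univ, true_and] at he he'
            exact huv (Subtype.ext (he.2.symm.trans he'.2))
        _ ≤ _ := by
            refine Finset.card_le_card fun e he => ?_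
            obtain ⟨u, hu, he⟩ := Finset.mem_biUnion.1 he
            exact Finset.mem_biUnion.2 ⟨.inr u, Finset.mem_toRight.1 hu, he⟩
    have := s.card_toLeft_add_card_toRight
    omega
  obtain ⟨F, hF, hFN⟩ := (Finset.all_card_le_biUnion_card_iff_exists_injective N).1 hall
  have hA : ∀ u : A, f (F (.inl u)).1 (F (.inl u)).2 ≠ 0 ∧ (F (.inl u)).1 = u := fun u => by
    simpa [N] using hFN (.inl u)
  have hB : ∀ t : B, f (F (.inr t)).1 (F (.inr t)).2 ≠ 0 ∧ (F (.inr t)).2 = t := fun t => by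
    simpa [N] using hFN (.inr t)
  refine ⟨fun u => if h : ∃ t ∈ W, f u t ≠ 0 then (F (.inl ⟨u, h⟩)).2 else u,
    fun t => if h : t ∈ W ∧ ∃ u, f u t ≠ 0 then (F (.inr ⟨t, h⟩)).1 else t,
    fun t ht u hut => ?_, fun t ht u hut => ?_, fun t ht u hut t' ht' u' hut' => ?_⟩
  · have h : ∃ t ∈ W, f u t ≠ 0 := ⟨t, ht, hut⟩
    obtain ⟨h1, h2⟩ := hA ⟨u, h⟩
    beta_reduce
    rw [dif_pos h]
    rwa [h2] at h1
  · have h : t ∈ W ∧ ∃ u, f u t ≠ 0 := ⟨ht, u, hut⟩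
    obtain ⟨h1, h2⟩ := hB ⟨t, h⟩
    beta_reduce
    rw [dif_pos h]
    rwa [h2] at h1
  · have h : ∃ t ∈ W, f u t ≠ 0 := ⟨t, ht, hut⟩
    have h' : t' ∈ W ∧ ∃ u, f u t' ≠ 0 := ⟨ht', u', hut'⟩
    beta_reduce
    rw [dif_pos h, dif_pos h']
    rintro ⟨h1, h2⟩
    have : F (.inl ⟨u, h⟩) = F (.inr ⟨t', h'⟩) :=
      Prod.ext ((hA ⟨u, h⟩).2.trans h1.symm) (h2.trans (hB ⟨t', h'⟩).2.symm)
    exact Sum.inl_ne_inr (hF this)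

/-- If every vertex sending flow to a root has two outgoing arcs, and every root receiving flow has
two incoming arcs, then flow can be rerouted around a cyclic sequence of roots. -/
lemma RootFlow.shift_cyclic (hf : RootFlow G W c r f)
    (hclosed : ∀ t ∈ W, c ≤ (rootClass r t).card → ∀ u, f u t = 0)
    (hreach : ∀ u v, f u v ≠ 0 → ∃ t ∈ W, Relation.ReflTransGen (fun a b => f a b ≠ 0) v t)
    (hout : ∀ t ∈ W, ∀ u, f u t ≠ 0 → ∃ v, v ≠ t ∧ f u v ≠ 0)
    (hin : ∀ t ∈ W, ∀ u, f u t ≠ 0 → ∃ v, v ≠ u ∧ f v t ≠ 0)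
    {u₀ t₀ : V} (ht₀ : t₀ ∈ W) (hut₀ : f u₀ t₀ ≠ 0) :
    ∃ g, RootFlow G W c r g ∧ rootValue W c r f ≤ rootValue W c r g ∧
      (flowSupport g).card < (flowSupport f).card := by
  classical
  obtain ⟨o, p, ho, hp, hop⟩ := exists_distinct_arcs hout hin
  let B := {t : V // t ∈ W ∧ ∃ u, f u t ≠ 0}
  have hpB : ∀ t : B, f (p t) t ≠ 0 := fun ⟨t, ht, u, hut⟩ => hp t ht u hut
  have hoB : ∀ t : B, f (p t) (o (p t)) ≠ 0 := fun t => ho t t.2.1 _ (hpB t)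
  choose P τ hτW hτ hP0 hP hP1 hcons using fun t : B => exists_unit_flow_to_root hreach (hoB t)
  let σ : B → B := fun t => ⟨τ t, hτW t, hτ t⟩
  obtain ⟨b₀, hb₀⟩ : (Function.periodicPts σ).Nonempty := by
    have b : B := ⟨t₀, ht₀, u₀, hut₀⟩
    obtain ⟨m, n, hmn, h⟩ := Finite.exists_ne_map_eq_of_infinite fun n : ℕ => σ^[n] b
    wlog hlt : m < n generalizing m n
    · exact this n m hmn.symm h.symm (lt_of_le_of_ne (not_lt.1 hlt) hmn.symm)
    refine ⟨σ^[m] b, Function.mk_mem_periodicPts (n := n - m) (by omega) ?_⟩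
    change σ^[n - m] (σ^[m] b) = σ^[m] b
    rw [← Function.iterate_add_apply, Nat.sub_add_cancel hlt.le]
    exact h.symm
  let C : Finset B := (Function.periodicPts σ).toFinite.toFinset
  have hC : ∀ b, b ∈ C ↔ b ∈ Function.periodicPts σ := fun b => Set.Finite.mem_toFinset _
  let D : V → V → ℝ := fun a b => ∑ t ∈ C, (arcFlow (p t) t a b + (-1) * P t a b)
  have hDout : ∀ x, outflow D x = ∑ t ∈ C, ((if x = p t then 1 else 0) - outflow (P t) x) := by
    intro x
    rw [outflow, Finset.sum_comm]
    refine Finset.sum_congr rfl fun t _ => ?_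
    have := outflow_add_mul (arcFlow (p t) t) (P t) (-1) x
    rw [outflow_arcFlow] at this
    exact this.trans (by ring)
  have hDin : ∀ x, inflow D x =
      ∑ t ∈ C, ((if x = (t : V) then 1 else 0) - inflow (P t) x) := by
    intro x
    rw [inflow, Finset.sum_comm]
    refine Finset.sum_congr rfl fun t _ => ?_
    have := inflow_add_mul (arcFlow (p t) t) (P t) (-1) x
    rw [inflow_arcFlow] at this
    exact this.trans (by ring)
  have hbal : ∀ x, outflow D x = inflow D x := by
    intro x
    have hperm : ∑ t ∈ C, (if x = (σ t : V) then (1 : ℝ) else 0) =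
        ∑ t ∈ C, if x = (t : V) then 1 else 0 := by
      have hbij := Function.bijOn_periodicPts σ
      refine Finset.sum_bij (fun t _ => σ t) (fun t ht => ?_) (fun s hs t ht h => ?_)
        (fun t ht => ?_) (fun t _ => rfl)
      · exact (hC _).2 (hbij.mapsTo ((hC t).1 ht))
      · exact hbij.injOn ((hC s).1 hs) ((hC t).1 ht) h
      · obtain ⟨s, hs, rfl⟩ := hbij.surjOn ((hC t).1 ht)
        exact ⟨s, (hC s).2 hs, rfl⟩
    have hD : outflow D x - inflow D x =
        ∑ t ∈ C, (if x = (σ t : V) then (1 : ℝ) else 0) -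
          ∑ t ∈ C, if x = (t : V) then 1 else 0 := by
      rw [hDout, hDin, ← Finset.sum_sub_distrib, ← Finset.sum_sub_distrib]
      refine Finset.sum_congr rfl fun t _ => ?_
      have := hcons t x
      simp only [σ]
      linarith
    linarith
  have hDf : ∀ a b, D a b ≠ 0 → f a b ≠ 0 := by
    intro a b hab
    obtain ⟨t, -, ht⟩ := Finset.exists_ne_zero_of_sum_ne_zero hab
    by_cases h : arcFlow (p t) t a b = 0
    · exact hP t a b fun h' => ht (by simp [h, h'])
    · obtain ⟨rfl, rfl⟩ := arcFlow_ne_zero h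
      exact hpB t
  have hin0 : ∀ t ∈ W, inflow D t = 0 := by
    intro t ht
    rw [← hbal]
    refine Finset.sum_eq_zero fun b _ => ?_
    by_contra h
    exact hDf t b h (hf.eq_zero_of_mem ht b)
  refine hf.shift (D := D) hclosed hDf ⟨p b₀, o (p b₀), ?_⟩ (fun x _ => hbal x) (fun x hx => ?_)
    (Finset.sum_eq_zero hin0) fun t ht => .inl (hin0 t ht).le
  · have harc : ∀ t : B, arcFlow (p t) t (p b₀) (o (p b₀)) = 0 := by
      intro t
      refine if_neg ?_
      rintro ⟨h1, h2⟩
      exact hop b₀ b₀.2.1 _ (hpB b₀) t t.2.1 _ (hpB t) ⟨h1.symm, h2⟩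
    simp only [D, harc, zero_add]
    refine Finset.sum_neg' (fun t _ => ?_) ⟨b₀, (hC b₀).2 hb₀, ?_⟩
    · linarith [hP0 t (p b₀) (o (p b₀))]
    · linarith [hP1 b₀]
  · rw [hbal, hDin]
    refine Finset.sum_nonpos fun t _ => ?_
    rw [if_neg (by rintro rfl; exact hf.ne_none t.2.1 hx)]
    linarith [inflow_nonneg (hP0 t) x]

/-- A flow can be rounded to a root map. -/
theorem RootFlow.exists_isRootMap (hf : RootFlow G W c r f) :
    ∃ r', IsRootMap G W r' ∧
      rootValue W c r f ≤ 2 * ∑ t ∈ W, min ((rootClass r' t).card : ℝ) c := by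
  induction hn : ({x | r x = none} : Finset V).card using Nat.strong_induction_on
    generalizing r f with
  | _ n ihn =>
  induction hm : (flowSupport f).card using Nat.strong_induction_on generalizing f with
  | _ m ihm =>
  have step : (∃ g, RootFlow G W c r g ∧ rootValue W c r f ≤ rootValue W c r g ∧
      (flowSupport g).card < (flowSupport f).card) → ∃ r', IsRootMap G W r' ∧
      rootValue W c r f ≤ 2 * ∑ t ∈ W, min ((rootClass r' t).card : ℝ) c := by
    rintro ⟨g, hg, hle, hlt⟩
    obtain ⟨r', hr', h⟩ := ihm _ (hm ▸ hlt) hg rfl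
    exact ⟨r', hr', hle.trans h⟩
  by_cases hclosed : ∀ t ∈ W, c ≤ (rootClass r t).card → ∀ u, f u t = 0
  swap
  · push Not at hclosed
    obtain ⟨t, ht, hc, u, hut⟩ := hclosed
    exact step (hf.delete_root ht hut hc)
  by_cases hreach :
      ∀ u v, f u v ≠ 0 → ∃ t ∈ W, Relation.ReflTransGen (fun a b => f a b ≠ 0) v t
  swap
  · push Not at hreach
    obtain ⟨u, v, huv, hv⟩ := hreach
    exact step (hf.delete_unreaching huv hv)
  by_cases hout : ∀ t ∈ W, ∀ u, f u t ≠ 0 → ∃ v, v ≠ t ∧ f u v ≠ 0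
  swap
  · push Not at hout
    obtain ⟨t, ht, u, hut, honly⟩ := hout
    obtain ⟨g, hg, hle⟩ := hf.contract ht hut honly
      (lt_of_not_ge fun h => hut (hclosed t ht h u))
    have hlt : ({x | Function.update r u (some t) x = none} : Finset V).card < n := by
      rw [← hn]
      refine Finset.card_lt_card ⟨fun x hx => ?_, fun h => ?_⟩
      · simp only [mem_filter, mem_univ, true_and] at hx ⊢
        by_cases hxu : x = u
        · simp [hxu] at hx
        · simpa [hxu] using hx
      · have := h (show u ∈ ({x | r x = none} : Finset V) by simpa using hf.tail u t hut)
        simp at this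
    obtain ⟨r', hr', h⟩ := ihn _ hlt hg rfl
    exact ⟨r', hr', hle.trans h⟩
  by_cases hin : ∀ t ∈ W, ∀ u, f u t ≠ 0 → ∃ v, v ≠ u ∧ f v t ≠ 0
  swap
  · push Not at hin
    obtain ⟨t, ht, v, hvt, huniq⟩ := hin
    obtain ⟨y, hyt, hvy⟩ := hout t ht v hvt
    exact step (hf.shift_of_unique hclosed hreach ht hvt
      (fun u hu => by_contra fun h => hu (huniq u h)) hvy hyt)
  by_cases hzero : ∀ t ∈ W, ∀ u, f u t = 0
  swap
  · push Not at hzero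
    obtain ⟨t, ht, u, hut⟩ := hzero
    exact step (hf.shift_cyclic hclosed hreach hout hin ht hut)
  refine ⟨r, hf.isRootMap, ?_⟩
  rw [rootValue, Finset.mul_sum]
  refine Finset.sum_le_sum fun t ht => ?_
  have h0 : inflow f t = 0 := Finset.sum_eq_zero fun u _ => hzero t ht u
  split_ifs with h
  · rw [min_eq_left h.le, h0]
    have : (0 : ℝ) ≤ (rootClass r t).card := Nat.cast_nonneg _
    linarith
  · rw [min_eq_right (not_lt.1 h)]

end RootFlow

/-- The total flow through a vertex, vertices in `W` being sinks. -/
def throughput (W : Finset V) (f : V → V → ℝ) (x : V) : ℝ :=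
  if x ∈ W then inflow f x else outflow f x

/-- A flow along the edges of `G` towards `W`: every vertex outside `W` emits at most one unit of
its own, and all throughputs are at most `c`. -/
structure IsCappedFlow (G : SimpleGraph V) (W : Finset V) (c : ℝ) (f : V → V → ℝ) : Prop where
  nonneg : ∀ u v, 0 ≤ f u v
  support : ∀ u v, f u v ≠ 0 → u ∉ W ∧ G.Adj u v
  outflow_le : ∀ u, u ∉ W → outflow f u ≤ 1 + inflow f u
  throughput_le : ∀ u, throughput W f u ≤ c

/-- A direction in which `f` may be modified so as to absorb additional amounts `a` arriving at
vertices and additional amounts `b` that have already passed the capacity constraint. -/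
structure IsAbsorption (G : SimpleGraph V) (W : Finset V) (c : ℝ) (f : V → V → ℝ) (a b : V → ℝ)
    (D : V → V → ℝ) : Prop where
  support : ∀ u v, D u v ≠ 0 → u ∉ W ∧ G.Adj u v
  pos_of_neg : ∀ u v, D u v < 0 → 0 < f u v
  outflow_eq : ∀ x, x ∉ W → outflow D x = inflow D x + a x + b x
  throughput_lt : ∀ x, 0 < inflow D x + a x → throughput W f x < c

/-- One more unit arriving at `x` can be absorbed. -/
def AbsorbsIn (G : SimpleGraph V) (W : Finset V) (c : ℝ) (f : V → V → ℝ) (x : V) : Prop :=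
  ∃ D, IsAbsorption G W c f (Pi.single x 1) 0 D

/-- One more unit leaving `x` can be absorbed. -/
def AbsorbsOut (G : SimpleGraph V) (W : Finset V) (c : ℝ) (f : V → V → ℝ) (x : V) : Prop :=
  ∃ D, IsAbsorption G W c f 0 (Pi.single x 1) D

section CappedFlow

variable {G : SimpleGraph V} {W : Finset V} {c : ℝ} {f : V → V → ℝ} {x y : V}

lemma absorbsIn_of_mem (hx : x ∈ W) (hlt : throughput W f x < c) : AbsorbsIn G W c f x := by
  refine ⟨0, ⟨by simp, by simp, fun y hy => ?_, fun y hy => ?_⟩⟩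
  · have : y ≠ x := by rintro rfl; exact hy hx
    simp [outflow, inflow, this]
  · by_cases h : y = x
    · exact h ▸ hlt
    · simp [inflow, h] at hy

lemma AbsorbsIn.absorbsOut (h : AbsorbsIn G W c f x) : AbsorbsOut G W c f x := by
  obtain ⟨D, hD⟩ := h
  refine ⟨D, hD.support, hD.pos_of_neg, fun y hy => ?_, fun y hy => hD.throughput_lt y ?_⟩
  · simpa using hD.outflow_eq y hy
  · have : (0 : ℝ) ≤ (Pi.single x 1 : V → ℝ) y := by
      by_cases h : y = x <;> simp [h]
    simp only [Pi.zero_apply, add_zero] at hy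
    linarith

lemma AbsorbsOut.absorbsIn (h : AbsorbsOut G W c f x) (hlt : throughput W f x < c) :
    AbsorbsIn G W c f x := by
  obtain ⟨D, hD⟩ := h
  refine ⟨D, hD.support, hD.pos_of_neg, fun y hy => ?_, fun y hy => ?_⟩
  · simpa using hD.outflow_eq y hy
  · by_cases h : y = x
    · exact h ▸ hlt
    · exact hD.throughput_lt y (by simpa [h] using hy)

lemma AbsorbsIn.absorbsOut_of_adj (h : AbsorbsIn G W c f y) (hx : x ∉ W) (hxy : G.Adj x y) :
    AbsorbsOut G W c f x := by
  obtain ⟨D, hD⟩ := h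
  refine ⟨fun u v => D u v + 1 * arcFlow x y u v, fun u v huv => ?_, fun u v huv => ?_,
    fun z hz => ?_, fun z hz => ?_⟩
  · by_cases h : arcFlow x y u v = 0
    · exact hD.support u v (by simpa [h] using huv)
    · obtain ⟨rfl, rfl⟩ := arcFlow_ne_zero h
      exact ⟨hx, hxy⟩
  · exact hD.pos_of_neg u v (by linarith [arcFlow_nonneg x y u v])
  · have := hD.outflow_eq z hz
    rw [outflow_add_mul, inflow_add_mul, outflow_arcFlow, inflow_arcFlow]
    simp only [Pi.single_apply, Pi.zero_apply] at this ⊢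
    linarith
  · rw [inflow_add_mul, inflow_arcFlow] at hz
    refine hD.throughput_lt z ?_
    simp only [Pi.single_apply, Pi.zero_apply] at hz ⊢
    linarith

lemma AbsorbsOut.absorbsIn_of_pos (hf : IsCappedFlow G W c f) (h : AbsorbsOut G W c f x)
    (hxy : 0 < f x y) : AbsorbsIn G W c f y := by
  obtain ⟨D, hD⟩ := h
  refine ⟨fun u v => D u v + (-1) * arcFlow x y u v, fun u v huv => ?_, fun u v huv => ?_,
    fun z hz => ?_, fun z hz => ?_⟩
  · by_cases h : arcFlow x y u v = 0
    · exact hD.support u v (by simpa [h] using huv)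
    · obtain ⟨rfl, rfl⟩ := arcFlow_ne_zero h
      exact hf.support u v hxy.ne'
  · by_cases h : arcFlow x y u v = 0
    · exact hD.pos_of_neg u v (by simpa [h] using huv)
    · obtain ⟨rfl, rfl⟩ := arcFlow_ne_zero h
      exact hxy
  · have := hD.outflow_eq z hz
    rw [outflow_add_mul, inflow_add_mul, outflow_arcFlow, inflow_arcFlow]
    simp only [Pi.single_apply, Pi.zero_apply] at this ⊢
    linarith
  · rw [inflow_add_mul, inflow_arcFlow] at hz
    refine hD.throughput_lt z ?_
    simp only [Pi.single_apply, Pi.zero_apply] at hz ⊢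
    linarith

lemma eventually_add_mul_le {a b d : ℝ} (hab : a ≤ b) (h : 0 < d → a < b) :
    ∀ᶠ δ in nhdsWithin (0 : ℝ) (Set.Ioi 0), a + δ * d ≤ b := by
  by_cases hd : 0 < d
  · have : Filter.Tendsto (fun δ : ℝ => a + δ * d) (nhdsWithin 0 (Set.Ioi 0)) (nhds a) := by
      have h2 : Continuous fun δ : ℝ => a + δ * d := by fun_prop
      simpa using (h2.tendsto 0).mono_left nhdsWithin_le_nhds
    exact (this.eventually_lt_const (h hd)).mono fun _ h => h.le
  · filter_upwards [self_mem_nhdsWithin] with δ hδ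
    have := mul_nonpos_of_nonneg_of_nonpos (le_of_lt hδ) (not_lt.1 hd)
    linarith

/-- In a flow of maximum value, a vertex at which more flow could be absorbed emits its whole
unit. -/
lemma IsCappedFlow.outflow_eq_of_absorbsIn (hf : IsCappedFlow G W c f)
    (hmax : ∀ g, IsCappedFlow G W c g → ∑ t ∈ W, inflow g t ≤ ∑ t ∈ W, inflow f t)
    (hxW : x ∉ W) (hx : AbsorbsIn G W c f x) : outflow f x = 1 + inflow f x := by
  obtain ⟨D, hD⟩ := hx
  by_contra hne
  have hlt := lt_of_le_of_ne (hf.outflow_le x hxW) hne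
  have hout : ∀ y, y ∉ W → outflow D y = inflow D y + if y = x then 1 else 0 := fun y hy => by
    simpa [Pi.single_apply] using hD.outflow_eq y hy
  have h1 : ∀ᶠ δ in nhdsWithin (0 : ℝ) (Set.Ioi 0), ∀ u v, -f u v + δ * -D u v ≤ 0 := by
    simp only [Filter.eventually_all]
    refine fun u v => eventually_add_mul_le (by simpa using hf.nonneg u v) fun h => ?_
    have := hD.pos_of_neg u v (by linarith)
    linarith
  have h2 : ∀ᶠ δ in nhdsWithin (0 : ℝ) (Set.Ioi 0),
      outflow f x - inflow f x + δ * 1 ≤ 1 :=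
    eventually_add_mul_le (by linarith) fun _ => by linarith
  have h3 : ∀ᶠ δ in nhdsWithin (0 : ℝ) (Set.Ioi 0), ∀ y,
      throughput W f y + δ * throughput W D y ≤ c := by
    simp only [Filter.eventually_all]
    refine fun y => eventually_add_mul_le (hf.throughput_le y) fun h => hD.throughput_lt y ?_
    simp only [throughput] at h
    split_ifs at h with hy
    · have hyx : y ≠ x := by rintro rfl; exact hxW hy
      simpa [hyx] using h
    · simpa [hout y hy, Pi.single_apply] using h
  obtain ⟨δ, ⟨⟨h1, h2⟩, h3⟩, hδ⟩ := (((h1.and h2).and h3).and self_mem_nhdsWithin).exists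
  have hδ : 0 < δ := hδ
  have hg : IsCappedFlow G W c fun u v => f u v + δ * D u v := by
    refine ⟨fun u v => by linarith [h1 u v], fun u v huv => ?_, fun y hy => ?_, fun y => ?_⟩
    · by_cases h : f u v = 0
      · exact hD.support u v fun h' => huv (by simp [h, h'])
      · exact hf.support u v h
    · rw [outflow_add_mul, inflow_add_mul, hout y hy]
      have := hf.outflow_le y hy
      split_ifs with h
      · subst h
        linarith
      · linarith
    · refine le_trans (le_of_eq ?_) (h3 y)
      simp only [throughput]
      split_ifs
      exacts [inflow_add_mul .., outflow_add_mul ..]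
  have hsum : ∑ t ∈ W, inflow D t = 1 := by
    have h0 : ∀ t ∈ W, outflow D t = 0 := fun t ht => Finset.sum_eq_zero fun v _ => by
      by_contra h
      exact (hD.support t v h).1 ht
    have h4 : ∑ y, (outflow D y - inflow D y) = 0 := by
      rw [Finset.sum_sub_distrib, sum_outflow_eq_sum_inflow, sub_self]
    have h5 : ∀ y, outflow D y - inflow D y =
        (if y = x then 1 else 0) - if y ∈ W then inflow D y else 0 := by
      intro y
      by_cases hy : y ∈ W
      · have hyx : y ≠ x := by rintro rfl; exact hxW hy
        simp [hy, hyx, h0 y hy]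
      · simp [hy, hout y hy]
    rw [Finset.sum_congr rfl fun y _ => h5 y, Finset.sum_sub_distrib] at h4
    simp only [Finset.sum_ite_eq', mem_univ, if_true, Finset.sum_ite_mem, univ_inter] at h4
    linarith
  have := hmax _ hg
  simp only [inflow_add_mul, Finset.sum_add_distrib, ← Finset.mul_sum, hsum] at this
  linarith

lemma exists_isMax_cappedFlow (G : SimpleGraph V) (W : Finset V) (hc : 0 ≤ c) :
    ∃ f, IsCappedFlow G W c f ∧
      ∀ g, IsCappedFlow G W c g → ∑ t ∈ W, inflow g t ≤ ∑ t ∈ W, inflow f t := by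
  have hcin : ∀ x, Continuous fun f : V → V → ℝ => inflow f x := fun x => by
    unfold inflow; fun_prop
  have hcout : ∀ x, Continuous fun f : V → V → ℝ => outflow f x := fun x => by
    unfold outflow; fun_prop
  have hclosed : IsClosed {f | IsCappedFlow G W c f} := by
    have : {f | IsCappedFlow G W c f} =
        {f | ∀ u v, 0 ≤ f u v} ∩ {f | ∀ u v, ¬ (u ∉ W ∧ G.Adj u v) → f u v = 0} ∩
        {f | ∀ u, u ∉ W → outflow f u ≤ 1 + inflow f u} ∩ {f | ∀ u, throughput W f u ≤ c} := by
      ext f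
      constructor
      · exact fun h => ⟨⟨⟨h.nonneg, fun u v huv => by_contra fun h' => huv (h.support u v h')⟩,
          h.outflow_le⟩, h.throughput_le⟩
      · exact fun h => ⟨h.1.1.1, fun u v huv => by_contra fun h' => huv (h.1.1.2 u v h'),
          h.1.2, h.2⟩
    rw [this]
    simp only [Set.ofPred_forall]
    refine ((IsClosed.inter ?_ ?_).inter ?_).inter ?_
    · exact isClosed_iInter fun u => isClosed_iInter fun v =>
        isClosed_le continuous_const (by fun_prop)
    · exact isClosed_iInter fun u => isClosed_iInter fun v => isClosed_iInter fun _ =>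
        isClosed_eq (by fun_prop) continuous_const
    · exact isClosed_iInter fun u => isClosed_iInter fun _ =>
        isClosed_le (hcout u) (continuous_const.add (hcin u))
    · refine isClosed_iInter fun u => isClosed_le ?_ continuous_const
      unfold throughput
      split_ifs
      exacts [hcin u, hcout u]
  have hcompact : IsCompact {f | IsCappedFlow G W c f} := by
    refine (isCompact_Icc (a := (0 : V → V → ℝ)) (b := fun _ _ => c)).of_isClosed_subset hclosed
      fun f hf => ⟨fun u v => hf.nonneg u v, fun u v => ?_⟩
    by_cases h : f u v = 0
    · simpa [h] using hc
    · have := hf.throughput_le u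
      rw [throughput, if_neg (hf.support u v h).1] at this
      exact (Finset.single_le_sum (f := fun v => f u v) (fun v _ => hf.nonneg u v)
        (mem_univ v)).trans this
  obtain ⟨f, hf, hmax⟩ := hcompact.exists_isMaxOn
    ⟨0, ⟨by simp, by simp, by simp [outflow, inflow], by simp [throughput, outflow, inflow, hc]⟩⟩
    (f := fun f => ∑ t ∈ W, inflow f t)
    (continuous_finsetSum _ fun t _ => hcin t).continuousOn
  exact ⟨f, hf, fun g hg => hmax hg⟩

/-- A flow and a separation certifying that its value is maximal. -/
theorem exists_cappedFlow_sepOf (G : SimpleGraph V) (W : Finset V) (hc : 0 ≤ c) :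
    ∃ f A B, IsCappedFlow G W c f ∧ SepOf (⊤ : G.Subgraph) A B ∧ W ⊆ A ∧
      c * (A ∩ B).card + (A \ B).card ≤ ∑ t ∈ W, (1 + inflow f t) := by
  classical
  obtain ⟨f, hf, hmax⟩ := exists_isMax_cappedFlow G W hc
  let A : Finset V := {x | x ∈ W ∨ AbsorbsOut G W c f x}
  let B : Finset V := {x | ¬ AbsorbsIn G W c f x}
  refine ⟨f, A, B, hf, ⟨?_, fun u v huv => ?_⟩, fun x hx => by simp [A, hx], ?_⟩
  · ext x
    by_cases h : AbsorbsIn G W c f x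
    · simp [A, B, h.absorbsOut]
    · simp [A, B, h]
  · simp only [A, B, mem_sdiff, mem_filter, mem_univ, true_and, not_not, not_or]
    rintro ⟨⟨-, hu⟩, -, hv, hv'⟩
    exact hv' (hu.absorbsOut_of_adj hv (SimpleGraph.Subgraph.adj_sub _ huv).symm)
  · have harcs : ∑ x, (if AbsorbsIn G W c f x then inflow f x else 0) =
        ∑ x, if x ∉ W ∧ AbsorbsOut G W c f x then outflow f x else 0 := by
      have h1 : ∀ x, (if AbsorbsIn G W c f x then inflow f x else 0) =
          ∑ u, if AbsorbsIn G W c f x then f u x else 0 := fun x => by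
        split_ifs <;> simp [inflow]
      have h2 : ∀ x, (if x ∉ W ∧ AbsorbsOut G W c f x then outflow f x else 0) =
          ∑ v, if x ∉ W ∧ AbsorbsOut G W c f x then f x v else 0 := fun x => by
        split_ifs <;> simp [outflow]
      simp only [h1, h2]
      rw [Finset.sum_comm]
      refine Finset.sum_congr rfl fun u _ => Finset.sum_congr rfl fun v _ => ?_
      by_cases h : f u v = 0
      · simp [h]
      · have huv := hf.support u v h
        have hiff : AbsorbsIn G W c f v ↔ u ∉ W ∧ AbsorbsOut G W c f u :=
          ⟨fun h => ⟨huv.1, h.absorbsOut_of_adj huv.1 huv.2⟩, fun h' =>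
            h'.2.absorbsIn_of_pos hf (lt_of_le_of_ne (hf.nonneg u v) (Ne.symm h))⟩
        simp only [hiff]
    have hcap : ∀ x, ¬ AbsorbsIn G W c f x → x ∈ W ∨ AbsorbsOut G W c f x →
        throughput W f x = c := by
      intro x hx hx'
      refine le_antisymm (hf.throughput_le x) (not_lt.1 fun hlt => hx ?_)
      exact hx'.elim (fun h => absorbsIn_of_mem h hlt) fun h => h.absorbsIn hlt
    have hterm : ∀ x, c * (if x ∈ A ∩ B then 1 else 0) + (if x ∈ A \ B then 1 else 0) ≤
        (if x ∈ W then 1 + inflow f x else 0) +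
          ((if x ∉ W ∧ AbsorbsOut G W c f x then outflow f x else 0) -
            if AbsorbsIn G W c f x then inflow f x else 0) := by
      intro x
      by_cases hW : x ∈ W
      · by_cases hI : AbsorbsIn G W c f x
        · simp [A, B, hW, hI]
        · have := hcap x hI (.inl hW)
          rw [throughput, if_pos hW] at this
          simp [A, B, hW, hI, this]
      · by_cases hI : AbsorbsIn G W c f x
        · have := hf.outflow_eq_of_absorbsIn hmax hW hI
          simp [A, B, hW, hI, hI.absorbsOut, this]
        · by_cases hO : AbsorbsOut G W c f x
          · have := hcap x hI (.inr hO)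
            rw [throughput, if_neg hW] at this
            simp [A, B, hW, hI, hO, this]
          · simp [A, B, hW, hI, hO]
    have := Finset.sum_le_sum fun x (_ : x ∈ univ) => hterm x
    rw [Finset.sum_add_distrib, Finset.sum_add_distrib, Finset.sum_sub_distrib, harcs, sub_self,
      ← Finset.mul_sum, add_zero] at this
    simpa only [Finset.sum_boole, Finset.sum_ite_mem, univ_inter,
      filter_univ_mem] using this

end CappedFlow

/-- The root map in which only the vertices of `W` have a root. -/
def trivialRoot (W : Finset V) (x : V) : Option V := if x ∈ W then some x else none

lemma trivialRoot_eq_some {W : Finset V} {x t : V} :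
    trivialRoot W x = some t ↔ x ∈ W ∧ x = t := by
  simp [trivialRoot]

lemma isRootMap_trivialRoot (G : SimpleGraph V) (W : Finset V) :
    IsRootMap G W (trivialRoot W) := by
  refine ⟨fun w hw => by simp [trivialRoot, hw], fun x t h => ?_, fun x t h => ?_⟩
  · obtain ⟨hx, rfl⟩ := trivialRoot_eq_some.1 h
    exact hx
  · obtain ⟨-, rfl⟩ := trivialRoot_eq_some.1 h
    exact .refl _

lemma card_rootClass_trivialRoot {W : Finset V} {t : V} (ht : t ∈ W) :
    (rootClass (trivialRoot W) t).card = 1 := by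
  rw [Finset.card_eq_one]
  refine ⟨t, ?_⟩
  ext x
  simp only [rootClass, trivialRoot_eq_some, mem_filter, mem_univ, true_and, mem_singleton]
  exact ⟨And.right, fun h => ⟨h ▸ ht, h⟩⟩

lemma IsCappedFlow.rootFlow {G : SimpleGraph V} {W : Finset V} {c : ℝ} {f : V → V → ℝ}
    (hf : IsCappedFlow G W c f) (hc : 0 ≤ c) : RootFlow G W c (trivialRoot W) f := by
  refine ⟨isRootMap_trivialRoot G W, hf.nonneg, fun u v h => ?_, fun u v h => ?_, fun u hu => ?_,
    fun u => ?_, fun t ht => ?_⟩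
  · simp [trivialRoot, (hf.support u v h).1]
  · by_cases hv : v ∈ W
    · exact .inr ⟨hv, v, by simp [trivialRoot, hv], (hf.support u v h).2⟩
    · exact .inl ⟨by simp [trivialRoot, hv], (hf.support u v h).2⟩
  · refine hf.outflow_le u fun h => ?_
    simp [trivialRoot, h] at hu
  · by_cases hu : u ∈ W
    · refine le_of_eq_of_le (Finset.sum_eq_zero fun v _ => ?_) hc
      by_contra h
      exact (hf.support u v h).1 hu
    · simpa [throughput, hu] using hf.throughput_le u
  · simpa [throughput, ht] using hf.throughput_le t

lemma IsCappedFlow.sum_le_rootValue {G : SimpleGraph V} {W : Finset V} {c : ℝ} {f : V → V → ℝ}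
    (hf : IsCappedFlow G W c f) (hc : 1 ≤ c) :
    ∑ t ∈ W, (1 + inflow f t) ≤ rootValue W c (trivialRoot W) f := by
  refine Finset.sum_le_sum fun t ht => ?_
  rw [card_rootClass_trivialRoot ht, Nat.cast_one]
  split_ifs
  · rfl
  · have := hf.throughput_le t
    rw [throughput, if_pos ht] at this
    linarith

/-- If the root classes have total size at least `3s` when capped at `s / (ε|W|)`, they come from
a tame cloud. -/
lemma IsRootMap.exists_isTameCloud {G : SimpleGraph V} {W : Finset V} {r : V → Option V}
    (hr : IsRootMap G W r) {s ε c : ℝ} (hs : 0 < s) (hc0 : 0 ≤ c) (hc : c * (ε * W.card) ≤ s)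
    (h : 3 * s ≤ ∑ t ∈ W, min ((rootClass r t).card : ℝ) c) :
    ∃ H : G.Subgraph, IsTameCloud G W H s ε := by
  obtain ⟨H, hH, hcard⟩ := hr.exists_isCloud
  refine ⟨H, hH, fun U hU hUcard => ?_⟩
  have hsize : ∑ t ∈ U, min ((rootClass r t).card : ℝ) c ≤ cloudSize H U := by
    rw [cloudSize, Nat.cast_sum]
    refine Finset.sum_le_sum fun t ht => ?_
    rw [hcard t (hU ht)]
    exact min_le_left _ _
  have hrest : ∑ t ∈ W \ U, min ((rootClass r t).card : ℝ) c ≤ c * (W \ U).card := by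
    rw [mul_comm, ← nsmul_eq_mul]
    exact Finset.sum_le_card_nsmul _ _ _ fun t _ => min_le_right _ _
  have hdiff : ((W \ U).card : ℝ) ≤ ε * W.card := by
    rw [Finset.card_sdiff_of_subset hU, Nat.cast_sub (Finset.card_le_card hU)]
    linarith
  have := mul_le_mul_of_nonneg_left hdiff hc0
  rw [← Finset.sum_sdiff hU] at h
  linarith

/-- If no separation of `G` is `(s, ε)`-skewed with respect to `W`, then `G` contains
an `(s, ε)`-tame `W`-cloud. -/
theorem exists_tameCloud_of_no_skewedSep (G : SimpleGraph V) (W : Finset V) (s ε : ℝ)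
    (hs : 0 < s) (hε0 : 0 < ε) (hε : ε < 1 / 2)
    (h : ¬ ∃ A B : Finset V, SkewedSepOf (⊤ : G.Subgraph) W A B s ε) :
    ∃ H : G.Subgraph, IsTameCloud G W H s ε := by
  have hW : 0 < (W.card : ℝ) := by
    rw [Nat.cast_pos, Finset.card_pos, Finset.nonempty_iff_ne_empty]
    rintro rfl
    exact h ⟨∅, univ, ⟨by simp, by simp⟩, by simp, by simp [hs.le], by simp⟩
  by_cases hsW : s < ε * W.card
  · obtain ⟨H, hH, hcard⟩ := (isRootMap_trivialRoot G W).exists_isCloud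
    refine ⟨H, hH, fun U hU hUcard => ?_⟩
    have hsize : cloudSize H U = U.card := by
      rw [Finset.card_eq_sum_ones]
      exact Finset.sum_congr rfl fun t ht => by
        rw [hcard t (hU ht), card_rootClass_trivialRoot (hU ht)]
    have := mul_lt_mul_of_pos_right hε hW
    rw [hsize]
    linarith
  have hpos : 0 < ε * W.card := mul_pos hε0 hW
  set c := s / (ε * W.card) with hcdef
  have hc1 : 1 ≤ c := (one_le_div hpos).2 (not_lt.1 hsW)
  have hcs : c * (ε * W.card) = s := div_mul_cancel₀ _ hpos.ne'
  have hc0 : 0 ≤ c := zero_le_one.trans hc1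
  obtain ⟨f, A, B, hf, hsep, hWA, hle⟩ := exists_cappedFlow_sepOf G W hc0
  have hvalue : 6 * s ≤ ∑ t ∈ W, (1 + inflow f t) := by
    refine le_trans ?_ hle
    by_cases hS : ((A ∩ B).card : ℝ) ≤ 6 * ε * W.card
    · have hA : 6 * s < A.card := not_le.1 fun hA => h ⟨A, B, hsep, hWA, hA, hS⟩
      have hsplit : ((A ∩ B).card : ℝ) + (A \ B).card = A.card := by
        exact_mod_cast Finset.card_inter_add_card_sdiff A B
      have := mul_le_mul_of_nonneg_right hc1 (Nat.cast_nonneg (A ∩ B).card : (0 : ℝ) ≤ _)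
      linarith
    · have := mul_le_mul_of_nonneg_left (not_le.1 hS).le hc0
      have : (0 : ℝ) ≤ (A \ B).card := Nat.cast_nonneg _
      linarith
  obtain ⟨r, hr, hround⟩ := (hf.rootFlow hc0).exists_isRootMap
  refine hr.exists_isTameCloud hs hc0 hcs.le ?_
  linarith [hf.sum_le_rootValue hc1]
end

section
/- The treewidth and the separation number are tied (linearly related): for every finite graph G, sn(G) − 1 ≤ tw(G) ≤ 105·sn(G). -/
open Finset

universe u

variable {V : Type u} [Fintype V] [DecidableEq V]

/-- The separation number of `G`: the smallest `s` such that every subgraph of `G`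
has a balanced separation of order at most `s`. -/
noncomputable def sepNum (G : SimpleGraph V) : ℕ :=
  sInf {s | ∀ H : G.Subgraph, ∃ A B : Finset V, BalancedSepOf H A B ∧ (A ∩ B).card ≤ s}

/-- `G` has a tree decomposition of width at most `w`: a tree `T` with bags
`β t ⊆ V(G)` covering all vertices and edges, such that for each vertex the set of
nodes whose bag contains it induces a connected subtree, with all bags of size at
most `w + 1`. -/
def HasTDWidthLE (G : SimpleGraph V) (w : ℕ) : Prop :=
  ∃ (ι : Type u) (T : SimpleGraph ι) (β : ι → Finset V),
    T.IsTree ∧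
    (∀ v : V, ∃ t, v ∈ β t) ∧
    (∀ u v : V, G.Adj u v → ∃ t, u ∈ β t ∧ v ∈ β t) ∧
    (∀ v : V, (T.induce {t | v ∈ β t}).Connected) ∧
    (∀ t, (β t).card ≤ w + 1)

/-- The treewidth of `G`: the minimum width of a tree decomposition of `G`. -/
noncomputable def treewidth (G : SimpleGraph V) : ℕ :=
  sInf {w | HasTDWidthLE G w}

set_option linter.unusedSectionVars false

namespace SimpleGraph

theorem IsAcyclic.sum {α β : Type*} {G : SimpleGraph α} {H : SimpleGraph β}
    (hG : G.IsAcyclic) (hH : H.IsAcyclic) : (G ⊕g H).IsAcyclic := by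
  rw [isAcyclic_iff_forall_adj_isBridge] at *
  rintro (u | u) (v | v) huv
  · rw [sum_adj_inl] at huv
    have hb := hG huv
    rw [isBridge_iff] at hb ⊢
    refine fun hr ↦ hb ?_
    suffices h : ∀ x y, ((G ⊕g H).deleteEdges {s(Sum.inl u, Sum.inl v)}).Walk x y →
        (G.deleteEdges {s(u, v)}).Reachable (x.elim id fun _ ↦ u) (y.elim id fun _ ↦ u) from
      hr.elim fun p ↦ h _ _ p
    intro x y p
    induction p with
    | nil => rfl
    | @cons x y z hxy _ ih =>
      refine Reachable.trans ?_ ih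
      rcases x with x | x <;> rcases y with y | y <;> simp at hxy ⊢
      exact Adj.reachable (by simpa using hxy)
  · simp at huv
  · simp at huv
  · rw [sum_adj_inr] at huv
    have hb := hH huv
    rw [isBridge_iff] at hb ⊢
    refine fun hr ↦ hb ?_
    suffices h : ∀ x y, ((G ⊕g H).deleteEdges {s(Sum.inr u, Sum.inr v)}).Walk x y →
        (H.deleteEdges {s(u, v)}).Reachable (x.elim (fun _ ↦ u) id) (y.elim (fun _ ↦ u) id) from
      hr.elim fun p ↦ h _ _ p
    intro x y p
    induction p with
    | nil => rfl
    | @cons x y z hxy _ ih =>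
      refine Reachable.trans ?_ ih
      rcases x with x | x <;> rcases y with y | y <;> simp at hxy ⊢
      exact Adj.reachable (by simpa using hxy)

theorem IsTree.sum_sup_edge {α β : Type*} {G : SimpleGraph α} {H : SimpleGraph β}
    (hG : G.IsTree) (hH : H.IsTree) (a : α) (b : β) :
    ((G ⊕g H) ⊔ edge (Sum.inl a) (Sum.inr b)).IsTree where
  connected := hG.connected.sum_sup_edge hH.connected
  isAcyclic := (hG.isAcyclic.sum hH.isAcyclic).sup_edge_of_not_reachable
    (not_reachable_sum_inl_inr a b)

/-- In a tree, stepping from `t` to a neighbour decreases the distance to every node on the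
side of that neighbour. -/
theorem IsTree.dist_add_one_le_of_reachable_induce {ι : Type*} {T : SimpleGraph ι} (hT : T.IsTree)
    {t t' s : ι} (ht : T.Adj t t') (hs : s ∈ ({t}ᶜ : Set ι)) (ht' : t' ∈ ({t}ᶜ : Set ι))
    (hr : (T.induce {t}ᶜ).Reachable ⟨t', ht'⟩ ⟨s, hs⟩) : T.dist t' s + 1 ≤ T.dist t s := by
  classical
  obtain ⟨p, hp⟩ := hr.exists_isPath
  let q : T.Walk t' s := p.map (Embedding.induce _).toHom
  have hq : q.IsPath := hp.map (f := (Embedding.induce (G := T) {t}ᶜ).toHom)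
    (Embedding.induce (G := T) {t}ᶜ).injective
  have hc : (Walk.cons ht q).IsPath := by
    rw [Walk.cons_isPath_iff]
    refine ⟨hq, fun h ↦ ?_⟩
    obtain ⟨x, -, hx⟩ := List.mem_map.1 (Walk.support_map (Embedding.induce {t}ᶜ).toHom p ▸ h)
    exact x.2 hx
  obtain ⟨d, hd, hdl⟩ := hT.connected.exists_path_of_dist t s
  have : Walk.cons ht q = d := (hT.existsUnique_path t s).unique hc hd
  rw [← hdl, ← this, Walk.length_cons]
  exact Nat.add_le_add_right (dist_le q) 1

theorem Connected.exists_adj_reachable_induce_compl {ι : Type*} {T : SimpleGraph ι}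
    (hT : T.Connected) {t s : ι} (hs : s ∈ ({t}ᶜ : Set ι)) :
    ∃ t', ∃ ht' : t' ∈ ({t}ᶜ : Set ι), T.Adj t t' ∧
      (T.induce {t}ᶜ).Reachable ⟨t', ht'⟩ ⟨s, hs⟩ := by
  obtain ⟨p, hp, -⟩ := hT.exists_path_of_dist t s
  cases p with
  | nil => simp at hs
  | @cons _ t' _ h q =>
    rw [Walk.cons_isPath_iff] at hp
    have hq : ∀ x ∈ q.support, x ∈ ({t}ᶜ : Set ι) := by
      rintro x hx rfl
      exact hp.2 hx
    exact ⟨t', hq _ q.start_mem_support, h, ⟨q.induce _ hq⟩⟩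

end SimpleGraph

/-- A weighted median of a tree: no component left after deleting it carries more than half of
the weight. -/
theorem SimpleGraph.IsTree.exists_median {ι α : Type*} {T : SimpleGraph ι} (hT : T.IsTree)
    (Z : Finset α) (s : α → ι) : ∃ t : ι, ∀ Y ⊆ Z, (∃ c : (T.induce {t}ᶜ).ConnectedComponent,
      ∀ z ∈ Y, ∃ h : s z ∈ ({t}ᶜ : Set ι), (T.induce {t}ᶜ).connectedComponentMk ⟨s z, h⟩ = c) →
      2 * Y.card ≤ Z.card := by
  classical
  have := hT.connected.nonempty
  let f : ι → ℕ := fun t ↦ ∑ z ∈ Z, T.dist t (s z)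
  obtain ⟨t, ht⟩ : ∃ t, ∀ t', f t ≤ f t' := ⟨_, fun t' ↦ Function.argmin_le f t'⟩
  refine ⟨t, ?_⟩
  rintro Y hYZ ⟨c, hc⟩
  by_contra! hlt
  obtain ⟨y, hy⟩ : Y.Nonempty := by
    rw [← Finset.card_pos]; omega
  obtain ⟨hy', hyc⟩ := hc y hy
  obtain ⟨t', ht', hadj, hr⟩ := hT.connected.exists_adj_reachable_induce_compl hy'
  have h1 : ∑ z ∈ Y, (T.dist t' (s z) + 1) ≤ ∑ z ∈ Y, T.dist t (s z) := by
    refine Finset.sum_le_sum fun z hz ↦ ?_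
    obtain ⟨hz', hzc⟩ := hc z hz
    refine hT.dist_add_one_le_of_reachable_induce hadj hz' ht' (hr.trans ?_)
    exact SimpleGraph.ConnectedComponent.exact (hyc.trans hzc.symm)
  have h2 : ∑ z ∈ Z \ Y, T.dist t' (s z) ≤ ∑ z ∈ Z \ Y, (T.dist t (s z) + 1) := by
    refine Finset.sum_le_sum fun z _ ↦ ?_
    have := hT.connected.dist_triangle (u := t') (v := t) (w := s z)
    rw [SimpleGraph.dist_eq_one_iff_adj.2 hadj.symm] at this
    omega
  have h3 : f t = _ := (Finset.sum_sdiff hYZ).symm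
  have h4 : f t' = _ := (Finset.sum_sdiff hYZ).symm
  have h5 := ht t'
  simp only [Finset.sum_add_distrib, Finset.sum_const, smul_eq_mul, mul_one] at h1 h2
  have h6 := Finset.card_sdiff_add_card_eq_card hYZ
  omega

/-- If every class of a colouring of `Y` has size at most `n / 2`, where `#Y ≤ n`, then the classes
can be distributed over two parts of size at most `2 n / 3`. -/
theorem Finset.exists_balanced_union_of_classes {α γ : Type*} [DecidableEq α] (Y : Finset α)
    (κ : α → γ) (n : ℕ) (hn : Y.card ≤ n)
    (h : ∀ X ⊆ Y, (∀ x ∈ X, ∀ y ∈ X, κ x = κ y) → 2 * X.card ≤ n) :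
    ∃ P ⊆ Y, (∀ x ∈ P, ∀ y ∈ Y, κ x = κ y → y ∈ P) ∧
      3 * P.card ≤ 2 * n ∧ 3 * (Y \ P).card ≤ 2 * n := by
  classical
  let F : Finset (Finset α) := Y.powerset.filter fun P ↦
    (∀ x ∈ P, ∀ y ∈ Y, κ x = κ y → y ∈ P) ∧ 3 * P.card ≤ 2 * n
  have hF : F.Nonempty := ⟨∅, by simp [F]⟩
  obtain ⟨P, hP, hmax⟩ := F.exists_max_image Finset.card hF
  simp only [F, mem_filter, mem_powerset] at hP hmax
  obtain ⟨hPY, hPc, hPn⟩ := hP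
  refine ⟨P, hPY, hPc, hPn, ?_⟩
  by_contra! hlt
  obtain ⟨y, hy⟩ : (Y \ P).Nonempty := by
    rw [← Finset.card_pos]; omega
  obtain ⟨hyY, hyP⟩ := mem_sdiff.1 hy
  let Q := Y.filter fun z ↦ κ z = κ y
  have hQ : 2 * Q.card ≤ n := h Q (filter_subset _ _) (by simp +contextual [Q])
  have hQP : Disjoint P Q := by
    rw [disjoint_left]
    intro x hx hxQ
    exact hyP (hPc x hx y hyY (mem_filter.1 hxQ).2)
  have hyQ : 0 < Q.card := card_pos.2 ⟨y, by simp [Q, hyY]⟩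
  have hYP := card_sdiff_add_card_eq_card hPY
  have h1 : Q.card ≤ P.card := by
    refine hmax Q ⟨filter_subset _ _, ?_, by omega⟩
    intro x hx z hz hxz
    simp only [Q, mem_filter] at hx ⊢
    exact ⟨hz, hxz ▸ hx.2⟩
  have h2 : ¬ 3 * (P ∪ Q).card ≤ 2 * n := by
    intro h3
    have := hmax (P ∪ Q) ⟨union_subset hPY (filter_subset _ _), ?_, h3⟩
    · rw [card_union_of_disjoint hQP] at this
      omega
    · intro x hx z hz hxz
      rw [mem_union] at hx ⊢
      refine hx.imp (fun hx ↦ hPc x hx z hz hxz) fun hx ↦ ?_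
      simp only [Q, mem_filter] at hx ⊢
      exact ⟨hz, hxz ▸ hx.2⟩
  rw [card_union_of_disjoint hQP] at h2
  omega

theorem HasTDWidthLE.exists_balancedSepOf {G : SimpleGraph V} {w : ℕ} (hw : HasTDWidthLE G w)
    (H : G.Subgraph) : ∃ A B : Finset V, BalancedSepOf H A B ∧ (A ∩ B).card ≤ w + 1 := by
  classical
  obtain ⟨ι, T, β, hT, hcov, hedge, hconn, hcard⟩ := hw
  choose s hs using hcov
  let Z : Finset V := H.verts.toFinset
  have hZ : (Z : Set V) = H.verts := by simp [Z]
  obtain ⟨t, ht⟩ := hT.exists_median Z s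
  have hst : ∀ {z}, z ∉ β t → ∀ q, z ∈ β q → q ∈ ({t}ᶜ : Set ι) := by
    rintro z hz q hq rfl
    exact hz hq
  let κ : V → Option (T.induce {t}ᶜ).ConnectedComponent := fun z ↦
    if h : z ∉ β t then some ((T.induce {t}ᶜ).connectedComponentMk ⟨s z, hst h _ (hs z)⟩) else none
  have hκ : ∀ z (h : z ∉ β t) q (hq : z ∈ β q),
      κ z = some ((T.induce {t}ᶜ).connectedComponentMk ⟨q, hst h q hq⟩) := by
    intro z h q hq
    simp only [κ, dif_pos h, Option.some.injEq, SimpleGraph.ConnectedComponent.eq]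
    have hr := (hconn z).preconnected ⟨s z, hs z⟩ ⟨q, hq⟩
    exact hr.map (SimpleGraph.induceHomOfLE T
      (show {q | z ∈ β q} ≤ ({t}ᶜ : Set ι) from fun q hq ↦ hst h q hq)).toHom
  obtain ⟨P, hPY, hPc, hP, hP'⟩ := (Z \ β t).exists_balanced_union_of_classes κ Z.card
    (Finset.card_le_card Finset.sdiff_subset) (by
      intro X hX hXc
      rcases X.eq_empty_or_nonempty with rfl | ⟨x, hx⟩
      · simp
      refine ht X (hX.trans Finset.sdiff_subset) ?_
      have hXt : ∀ x ∈ X, x ∉ β t := fun x hx ↦ (Finset.mem_sdiff.1 (hX hx)).2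
      refine ⟨(T.induce {t}ᶜ).connectedComponentMk ⟨s x, hst (hXt x hx) _ (hs x)⟩,
        fun z hz ↦ ⟨hst (hXt z hz) _ (hs z), ?_⟩⟩
      · have := hXc z hz x hx
        rwa [hκ z (hXt z hz) _ (hs z), hκ x (hXt x hx) _ (hs x), Option.some.injEq] at this)
  have hnc : H.verts.ncard = Z.card := by rw [← hZ, Set.ncard_coe_finset]
  have hP₁ : ∀ x ∈ P, x ∈ Z ∧ x ∉ β t := fun x hx ↦ Finset.mem_sdiff.1 (hPY hx)
  refine ⟨(Z ∩ β t) ∪ P, Z \ P, ⟨⟨?_, ?_⟩, ?_, ?_⟩, ?_⟩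
  · rw [← hZ]
    ext x
    have := hP₁ x
    simp only [Set.mem_union, Finset.mem_coe, Finset.mem_union, Finset.mem_inter,
      Finset.mem_sdiff]
    tauto
  · rintro u v huv ⟨hu, hv⟩
    have hu' : u ∈ P := by
      have := hP₁ u
      simp only [Finset.mem_union, Finset.mem_inter, Finset.mem_sdiff] at hu
      tauto
    have hv' : v ∈ Z ∧ v ∉ P ∧ v ∉ β t := by
      simp only [Finset.mem_union, Finset.mem_inter, Finset.mem_sdiff] at hv
      tauto
    obtain ⟨q, huq, hvq⟩ := hedge u v huv.adj_sub
    refine hv'.2.1 (hPc u hu' v (Finset.mem_sdiff.2 ⟨hv'.1, hv'.2.2⟩) ?_)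
    rw [hκ u (hP₁ u hu').2 q huq, hκ v hv'.2.2 q hvq]
  · rw [hnc]
    refine le_trans (Nat.mul_le_mul_left 3 (Finset.card_le_card ?_)) hP
    intro x
    simp only [Finset.mem_union, Finset.mem_inter, Finset.mem_sdiff]
    tauto
  · rw [hnc]
    refine le_trans (Nat.mul_le_mul_left 3 (Finset.card_le_card ?_)) hP'
    intro x
    simp only [Finset.mem_union, Finset.mem_inter, Finset.mem_sdiff]
    tauto
  · refine le_trans (Finset.card_le_card ?_) (hcard t)
    intro x
    simp only [Finset.mem_union, Finset.mem_inter, Finset.mem_sdiff]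
    tauto


/-- The subgraph of `G` induced on `B` has a tree decomposition of width at most `w`
with a bag containing `Z`. -/
def HasRootedTDWidthLE (G : SimpleGraph V) (w : ℕ) (B Z : Finset V) : Prop :=
  ∃ (ι : Type u) (T : SimpleGraph ι) (β : ι → Finset V) (r : ι),
    T.IsTree ∧
    (∀ t, β t ⊆ B) ∧
    (∀ v ∈ B, ∃ t, v ∈ β t) ∧
    (∀ u ∈ B, ∀ v ∈ B, G.Adj u v → ∃ t, u ∈ β t ∧ v ∈ β t) ∧
    (∀ v : V, (T.induce {t | v ∈ β t}).Preconnected) ∧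
    (∀ t, (β t).card ≤ w + 1) ∧
    Z ⊆ β r

theorem HasRootedTDWidthLE.of_card_le (G : SimpleGraph V) {w : ℕ} {B Z : Finset V}
    (hB : B.card ≤ w + 1) (hZ : Z ⊆ B) : HasRootedTDWidthLE G w B Z := by
  refine ⟨PUnit, ⊥, fun _ ↦ B, PUnit.unit, .of_subsingleton, fun _ ↦ subset_rfl,
    fun v hv ↦ ⟨PUnit.unit, hv⟩, fun u hu v hv _ ↦ ⟨PUnit.unit, hu, hv⟩, fun v s t ↦ ?_,
    fun _ ↦ hB, hZ⟩
  rw [Subsingleton.elim s t]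

theorem HasRootedTDWidthLE.mono_root {G : SimpleGraph V} {w : ℕ} {B Z Z' : Finset V}
    (h : HasRootedTDWidthLE G w B Z) (hZ : Z' ⊆ Z) : HasRootedTDWidthLE G w B Z' := by
  obtain ⟨ι, T, β, r, h₁, h₂, h₃, h₄, h₅, h₆, h₇⟩ := h
  exact ⟨ι, T, β, r, h₁, h₂, h₃, h₄, h₅, h₆, hZ.trans h₇⟩

theorem HasRootedTDWidthLE.hasTDWidthLE {G : SimpleGraph V} {w : ℕ} {Z : Finset V}
    (h : HasRootedTDWidthLE G w univ Z) : HasTDWidthLE G w := by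
  obtain ⟨ι, T, β, r, hT, -, hcov, hedge, hconn, hcard, -⟩ := h
  refine ⟨ι, T, β, hT, by simpa using hcov, by simpa using hedge, fun v ↦ ?_, hcard⟩
  obtain ⟨t, ht⟩ := hcov v (mem_univ v)
  have : Nonempty {t | v ∈ β t} := ⟨⟨t, ht⟩⟩
  exact ⟨hconn v⟩

/-- Two tree decompositions can be joined along bags containing the common vertices. -/
theorem HasRootedTDWidthLE.glue {G : SimpleGraph V} {w : ℕ} {B₁ B₂ Z₁ Z₂ : Finset V}
    (h₁ : HasRootedTDWidthLE G w B₁ Z₁) (h₂ : HasRootedTDWidthLE G w B₂ Z₂)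
    (hZ₁ : B₁ ∩ B₂ ⊆ Z₁) (hZ₂ : B₁ ∩ B₂ ⊆ Z₂)
    (hadj : ∀ u ∈ B₁ \ B₂, ∀ v ∈ B₂ \ B₁, ¬ G.Adj u v) :
    HasRootedTDWidthLE G w (B₁ ∪ B₂) Z₁ := by
  obtain ⟨ι₁, T₁, β₁, r₁, hT₁, hsub₁, hcov₁, hedge₁, hconn₁, hcard₁, hr₁⟩ := h₁
  obtain ⟨ι₂, T₂, β₂, r₂, hT₂, hsub₂, hcov₂, hedge₂, hconn₂, hcard₂, hr₂⟩ := h₂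
  let T := (T₁ ⊕g T₂) ⊔ SimpleGraph.edge (Sum.inl r₁) (Sum.inr r₂)
  let β : ι₁ ⊕ ι₂ → Finset V := Sum.elim β₁ β₂
  have hl : ∀ v s t (hs : v ∈ β₁ s) (ht : v ∈ β₁ t),
      (T.induce {t | v ∈ β t}).Reachable ⟨Sum.inl s, hs⟩ ⟨Sum.inl t, ht⟩ := by
    intro v s t hs ht
    let f : T₁.induce {t | v ∈ β₁ t} →g T.induce {t | v ∈ β t} :=
      ⟨fun x ↦ ⟨Sum.inl x.1, x.2⟩, fun {x y} h ↦ Or.inl (by simpa using h)⟩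
    exact (hconn₁ v ⟨s, hs⟩ ⟨t, ht⟩).map f
  have hr : ∀ v s t (hs : v ∈ β₂ s) (ht : v ∈ β₂ t),
      (T.induce {t | v ∈ β t}).Reachable ⟨Sum.inr s, hs⟩ ⟨Sum.inr t, ht⟩ := by
    intro v s t hs ht
    let f : T₂.induce {t | v ∈ β₂ t} →g T.induce {t | v ∈ β t} :=
      ⟨fun x ↦ ⟨Sum.inr x.1, x.2⟩, fun {x y} h ↦ Or.inl (by simpa using h)⟩
    exact (hconn₂ v ⟨s, hs⟩ ⟨t, ht⟩).map f
  have hlr : ∀ v s t (hs : v ∈ β₁ s) (ht : v ∈ β₂ t),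
      (T.induce {t | v ∈ β t}).Reachable ⟨Sum.inl s, hs⟩ ⟨Sum.inr t, ht⟩ := by
    intro v s t hs ht
    have hv : v ∈ B₁ ∩ B₂ := mem_inter.2 ⟨hsub₁ s hs, hsub₂ t ht⟩
    have hv₁ := hr₁ (hZ₁ hv)
    have hv₂ := hr₂ (hZ₂ hv)
    refine (hl v s r₁ hs hv₁).trans (SimpleGraph.Reachable.trans ?_ (hr v r₂ t hv₂ ht))
    refine SimpleGraph.Adj.reachable ?_
    simp [T, SimpleGraph.edge_adj]
  refine ⟨ι₁ ⊕ ι₂, T, β, Sum.inl r₁, hT₁.sum_sup_edge hT₂ _ _, ?_, ?_, ?_, ?_, ?_, hr₁⟩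
  · rintro (t | t)
    · exact (hsub₁ t).trans subset_union_left
    · exact (hsub₂ t).trans subset_union_right
  · intro v hv
    rcases mem_union.1 hv with hv | hv
    · obtain ⟨t, ht⟩ := hcov₁ v hv
      exact ⟨Sum.inl t, ht⟩
    · obtain ⟨t, ht⟩ := hcov₂ v hv
      exact ⟨Sum.inr t, ht⟩
  · intro u hu v hv huv
    have h : (u ∈ B₁ ∧ v ∈ B₁) ∨ (u ∈ B₂ ∧ v ∈ B₂) := by
      have h1 := hadj u
      have h2 := hadj v
      have h3 := huv.symm
      grind
    rcases h with h | h
    · obtain ⟨t, ht⟩ := hedge₁ u h.1 v h.2 huv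
      exact ⟨Sum.inl t, ht⟩
    · obtain ⟨t, ht⟩ := hedge₂ u h.1 v h.2 huv
      exact ⟨Sum.inr t, ht⟩
  · rintro v ⟨s | s, hs⟩ ⟨t | t, ht⟩
    · exact hl v s t hs ht
    · exact hlr v s t hs ht
    · exact (hlr v t s ht hs).symm
    · exact hr v s t hs ht
  · rintro (t | t)
    · exact hcard₁ t
    · exact hcard₂ t

/-- `(A, B)` is a separation of the graph `G`. -/
def IsSep (G : SimpleGraph V) (A B : Finset V) : Prop :=
  A ∪ B = univ ∧ ∀ u ∈ A \ B, ∀ v ∈ B \ A, ¬ G.Adj u v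

theorem card_inter_eq_card_inter_inter_add (W A : Finset V) (B : Finset V) :
    (W ∩ A).card = (W ∩ (A \ B)).card + (W ∩ (A ∩ B)).card := by
  rw [← card_union_of_disjoint]
  · congr 1
    grind
  · rw [disjoint_left]
    grind

theorem HasRootedTDWidthLE.of_balanced {G : SimpleGraph V} {K : ℕ}
    (hbal : ∀ W : Finset V, W.card = 3 * K + 1 → ∃ A B, IsSep G A B ∧ (A ∩ B).card ≤ K ∧
      3 * (W ∩ (A \ B)).card ≤ 2 * W.card ∧ 3 * (W ∩ (B \ A)).card ≤ 2 * W.card)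
    (B Z : Finset V) (hZB : Z ⊆ B) (hZ : Z.card ≤ 3 * K + 1) :
    HasRootedTDWidthLE G (4 * K) B Z := by
  induction hn : B.card using Nat.strong_induction_on generalizing B Z with
  | _ n ih =>
  by_cases hB : B.card ≤ 4 * K + 1
  · exact .of_card_le G hB hZB
  obtain ⟨W, hZW, hWB, hW⟩ := exists_subsuperset_card_eq hZB hZ (by omega)
  obtain ⟨A, D, ⟨hcov, hAD⟩, hK, hWA, hWD⟩ := hbal W hW
  have hcov' : ∀ x, x ∈ A ∨ x ∈ D := fun x ↦ by
    rw [← mem_union, hcov]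
    exact mem_univ x
  have hAc := card_inter_eq_card_inter_inter_add W A D
  have hDc := card_inter_eq_card_inter_inter_add W D A
  have hAl : (W ∩ (A ∩ D)).card ≤ (A ∩ D).card := card_le_card inter_subset_right
  rw [inter_comm D A] at hDc
  have hlt : ∀ C, (W ∩ C).card ≤ 3 * K → (C ∩ B).card < n := by
    intro C hC
    rw [← hn]
    refine card_lt_card ((ssubset_iff_subset_ne).2 ⟨inter_subset_right, fun h ↦ ?_⟩)
    have : W ∩ C = W := inter_eq_left.2 (hWB.trans (inter_eq_right.1 h))
    rw [this] at hC
    omega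
  let S := A ∩ D ∩ B
  have hS : S.card ≤ K := (card_le_card inter_subset_left).trans hK
  have key : ∀ C, (W ∩ C).card ≤ 3 * K → S ⊆ C → (W ∩ (C ∩ B) ∪ S).card ≤ 3 * K + 1 →
      HasRootedTDWidthLE G (4 * K) (C ∩ B) (W ∩ (C ∩ B) ∪ S) := by
    intro C hC hSC hcard
    refine ih _ (hlt C hC) _ _ ?_ hcard rfl
    exact union_subset inter_subset_right (subset_inter hSC inter_subset_right)
  have hZ₁ : (W ∩ (A ∩ B) ∪ S).card ≤ 3 * K + 1 := by
    have : W ∩ (A ∩ B) ∪ S ⊆ (W ∩ (A \ D)) ∪ (A ∩ D) := by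
      simp only [S]
      clear * - hcov' hWB
      grind
    have := (card_le_card this).trans (card_union_le _ _)
    omega
  have hZ₂ : (W ∩ (D ∩ B) ∪ S).card ≤ 3 * K + 1 := by
    have : W ∩ (D ∩ B) ∪ S ⊆ (W ∩ (D \ A)) ∪ (A ∩ D) := by
      simp only [S]
      clear * - hcov' hWB
      grind
    have := (card_le_card this).trans (card_union_le _ _)
    omega
  have h₁ := key A (by omega) (inter_subset_left.trans inter_subset_left) hZ₁
  have h₂ := key D (by omega) (inter_subset_left.trans inter_subset_right) hZ₂
  have h₀ : HasRootedTDWidthLE G (4 * K) (W ∪ S) (W ∪ S) := by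
    refine .of_card_le G ((card_union_le _ _).trans ?_) subset_rfl
    omega
  have h₃ : HasRootedTDWidthLE G (4 * K) (W ∪ S ∪ A ∩ B) (W ∪ S) := by
    refine h₀.glue h₁ ?_ ?_ fun u hu v hv huv ↦ ?_
    · exact inter_subset_left
    · rw [union_inter_distrib_right]
      exact union_subset_union (inter_subset_inter_left subset_rfl) inter_subset_left
    · have hmem : v ∈ A \ D ∧ u ∈ D \ A := by
        simp only [S] at hu hv
        clear * - hu hv hcov' hWB
        grind
      exact hAD v hmem.1 u hmem.2 huv.symm
  have h₄ : HasRootedTDWidthLE G (4 * K) (W ∪ S ∪ A ∩ B ∪ D ∩ B) (W ∪ S) := by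
    refine h₃.glue h₂ ?_ ?_ fun u hu v hv huv ↦ ?_
    · simp only [S]
      clear * -
      grind
    · simp only [S]
      clear * -
      grind
    · have hmem : u ∈ A \ D ∧ v ∈ D \ A := by
        simp only [S] at hu hv
        clear * - hu hv hcov' hWB
        grind
      exact hAD u hmem.1 v hmem.2 huv
  have hun : W ∪ S ∪ A ∩ B ∪ D ∩ B = B := by
    simp only [S]
    clear * - hcov' hWB
    grind
  rw [hun] at h₄
  exact h₄.mono_root (hZW.trans subset_union_left)

/-- `(A, B)` is a separation of order at most `K` and `B \ A` contains more than two thirds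
of `W`. -/
def IsBigSep (G : SimpleGraph V) (K : ℕ) (W A B : Finset V) : Prop :=
  IsSep G A B ∧ (A ∩ B).card ≤ K ∧ 2 * W.card < 3 * (W ∩ (B \ A)).card

/-- No separation of order at most `K` splits `W` evenly. -/
def IsWellLinked (G : SimpleGraph V) (K : ℕ) (W : Finset V) : Prop :=
  ∀ A B, IsSep G A B → (A ∩ B).card ≤ K →
    2 * W.card < 3 * (W ∩ (A \ B)).card ∨ 2 * W.card < 3 * (W ∩ (B \ A)).card

theorem IsBigSep.split {G : SimpleGraph V} {K : ℕ} {W A B C D : Finset V}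
    (hW : IsWellLinked G K W) (h : IsBigSep G K W A B) (hCD : C ∪ D = B)
    (hadj : ∀ u ∈ C \ D, ∀ v ∈ D \ C, ¬ G.Adj u v)
    (hC : ((A ∪ C) ∩ D).card ≤ K) (hD : ((A ∪ D) ∩ C).card ≤ K) :
    IsBigSep G K W (A ∪ C) D ∨ IsBigSep G K W (A ∪ D) C := by
  obtain ⟨⟨hcov, hAB⟩, -, hbig⟩ := h
  subst hCD
  have hs₁ : IsSep G (A ∪ C) D := by
    refine ⟨by rw [union_assoc]; exact hcov, fun u hu v hv huv ↦ ?_⟩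
    by_cases huC : u ∈ C
    · exact hadj u (by grind) v (by grind) huv
    · exact hAB u (by grind) v (by grind) huv
  have hs₂ : IsSep G (A ∪ D) C := by
    refine ⟨by rw [union_assoc, union_comm D]; exact hcov, fun u hu v hv huv ↦ ?_⟩
    by_cases huD : u ∈ D
    · exact hadj v (by grind) u (by grind) huv.symm
    · exact hAB u (by grind) v (by grind) huv
  by_contra! hcon
  have h₁ := (hW _ _ hs₁ hC).resolve_right fun h ↦ hcon.1 ⟨hs₁, hC, h⟩
  have h₂ := (hW _ _ hs₂ hD).resolve_right fun h ↦ hcon.2 ⟨hs₂, hD, h⟩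
  have hsum := card_union_add_card_inter (W ∩ ((A ∪ C) \ D)) (W ∩ ((A ∪ D) \ C))
  have hun : (W ∩ ((A ∪ C) \ D) ∪ W ∩ ((A ∪ D) \ C)).card ≤ W.card :=
    card_le_card (union_subset inter_subset_left inter_subset_left)
  have hin : (W ∩ ((A ∪ C) \ D) ∩ (W ∩ ((A ∪ D) \ C))).card +
      (W ∩ ((C ∪ D) \ A)).card ≤ W.card := by
    rw [← card_union_of_disjoint]
    · exact card_le_card (union_subset (inter_subset_left.trans inter_subset_left)
        inter_subset_left)
    · rw [disjoint_left]
      clear * -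
      grind
  omega

open Classical in
/-- The vertices of `Y` outside `U` with a neighbour in `U`. -/
noncomputable def outerNeighbors (G : SimpleGraph V) (Y U : Finset V) : Finset V :=
  {v ∈ Y \ U | ∃ u ∈ U, G.Adj u v}

theorem mem_outerNeighbors {G : SimpleGraph V} {Y U : Finset V} {v : V} :
    v ∈ outerNeighbors G Y U ↔ v ∈ Y ∧ v ∉ U ∧ ∃ u ∈ U, G.Adj u v := by
  simp [outerNeighbors, and_assoc]

theorem card_outerNeighbors_union_add_card_outerNeighbors_inter (G : SimpleGraph V)
    (Y U U' : Finset V) :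
    (outerNeighbors G Y (U ∪ U')).card + (outerNeighbors G Y (U ∩ U')).card ≤
      (outerNeighbors G Y U).card + (outerNeighbors G Y U').card := by
  rw [← card_union_add_card_inter, ← card_union_add_card_inter (outerNeighbors G Y U)]
  refine Nat.add_le_add (card_le_card fun v hv ↦ ?_) (card_le_card fun v hv ↦ ?_)
  · simp only [mem_union, mem_inter, mem_outerNeighbors] at hv ⊢
    grind
  · simp only [mem_union, mem_inter, mem_outerNeighbors] at hv ⊢
    grind

theorem outerNeighbors_subset_union {G : SimpleGraph V} {Y U U' : Finset V} (h : U ⊆ U') :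
    outerNeighbors G Y U ⊆ U' ∪ outerNeighbors G Y U' := by
  intro v hv
  simp only [mem_union, mem_outerNeighbors] at hv ⊢
  grind

/-- Every subset `U` of `P` has at least `#U / r` outer neighbours in `P ∪ X`. -/
def Expands (G : SimpleGraph V) (r : ℕ) (X P : Finset V) : Prop :=
  ∀ U ⊆ P, U.card ≤ r * (outerNeighbors G (P ∪ X) U).card

theorem Expands.exists_tight {G : SimpleGraph V} {r : ℕ} {X P M : Finset V} (hr : 0 < r)
    (hP : Expands G r X P) (hM : Disjoint M X)
    (hmax : ∀ v ∈ M \ P, ¬ Expands G r X (insert v P)) :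
    ∃ U ⊆ P, U.card = r * (outerNeighbors G (P ∪ X) U).card ∧
      ∀ v ∈ M \ P, ∀ y ∈ P ∪ X, G.Adj v y → y ∈ U ∪ outerNeighbors G (P ∪ X) U := by
  set Y := P ∪ X with hY
  replace hP : ∀ U ⊆ P, U.card ≤ r * (outerNeighbors G Y U).card := hP
  let tight : Finset (Finset V) :=
    {U ∈ P.powerset | U.card = r * (outerNeighbors G Y U).card}
  have htight : ∀ U, U ∈ tight ↔ U ⊆ P ∧ U.card = r * (outerNeighbors G Y U).card := by
    simp [tight]
  have hne : tight.Nonempty := by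
    refine ⟨∅, (htight _).2 ⟨empty_subset _, ?_⟩⟩
    have : outerNeighbors G Y ∅ = ∅ := by simp [outerNeighbors]
    simp [this]
  obtain ⟨U, hU, hUmax⟩ := exists_max_image tight card hne
  rw [htight] at hU
  have hcont : ∀ U' ∈ tight, U' ⊆ U := by
    intro U' hU'
    have h' := (htight _).1 hU'
    have hun : U ∪ U' ∈ tight := by
      refine (htight _).2 ⟨union_subset hU.1 h'.1, ?_⟩
      have h₁ := hP (U ∪ U') (union_subset hU.1 h'.1)
      have h₂ := hP (U ∩ U') (inter_subset_left.trans hU.1)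
      have h₃ := Nat.mul_le_mul_left r
        (card_outerNeighbors_union_add_card_outerNeighbors_inter G Y U U')
      have h₄ := card_union_add_card_inter U U'
      rw [mul_add, mul_add] at h₃
      omega
    have := eq_of_subset_of_card_le (subset_union_left (s₁ := U) (s₂ := U')) (hUmax _ hun)
    rw [this]
    exact subset_union_right
  refine ⟨U, hU.1, hU.2, fun v hv y hy hvy ↦ ?_⟩
  have hvP := (mem_sdiff.1 hv).2
  have hvX : v ∉ X := disjoint_left.1 hM (mem_sdiff.1 hv).1
  have hne := hmax v hv
  simp only [Expands, not_forall, not_le] at hne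
  obtain ⟨U₁, hU₁, hlt⟩ := hne
  have hvU : v ∈ U₁ := by
    by_contra hvU
    have hsub : U₁ ⊆ P := (subset_insert_iff_of_notMem hvU).1 hU₁
    have h₁ := hP U₁ hsub
    have h₂ : outerNeighbors G Y U₁ ⊆ outerNeighbors G (insert v P ∪ X) U₁ := by
      intro x hx
      simp only [mem_outerNeighbors, hY, mem_union, mem_insert] at hx ⊢
      tauto
    have h₃ := Nat.mul_le_mul_left r (card_le_card h₂)
    omega
  have hsub : U₁.erase v ⊆ P := by
    intro x hx
    have := hU₁ (mem_of_mem_erase hx)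
    have := ne_of_mem_erase hx
    grind
  have hcard := card_erase_add_one hvU
  have h₁ := hP _ hsub
  have h₂ : outerNeighbors G Y (U₁.erase v) ⊆ outerNeighbors G (insert v P ∪ X) U₁ := by
    intro x hx
    simp only [mem_outerNeighbors, hY, mem_union, mem_insert, mem_erase] at hx ⊢
    have : x ≠ v := by
      rintro rfl
      tauto
    obtain ⟨h₁, h₂, u, hu, hux⟩ := hx
    exact ⟨by tauto, by tauto, u, hu.2, hux⟩
  have h₃ := Nat.mul_le_mul_left r (card_le_card h₂)
  have ht : U₁.erase v ∈ tight := (htight _).2 ⟨hsub, by omega⟩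
  have heq : outerNeighbors G Y (U₁.erase v) = outerNeighbors G (insert v P ∪ X) U₁ := by
    refine eq_of_subset_of_card_le h₂ (Nat.le_of_mul_le_mul_left ?_ hr)
    omega
  by_cases hyU : y ∈ U₁.erase v
  · exact mem_union_left _ (hcont _ ht hyU)
  · refine outerNeighbors_subset_union (hcont _ ht) ?_
    rw [heq, mem_outerNeighbors]
    rw [hY] at hy
    refine ⟨?_, ?_, v, hvU, hvy⟩
    · simp only [mem_union, mem_insert] at hy ⊢
      tauto
    · intro h
      exact hyU (mem_erase.2 ⟨hvy.ne', h⟩)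

/-- Moving the non-expanding part out of `P` yields a separation of small order. -/
theorem IsBigSep.of_tight {G : SimpleGraph V} {K : ℕ} {W A B P U : Finset V}
    (h : IsBigSep G K W A B) (hP : P ⊆ A \ B) (hU : U ⊆ P)
    (hc : (outerNeighbors G (P ∪ A ∩ B) U).card ≤ K)
    (hadj : ∀ v ∈ (A \ B) \ P, ∀ y ∈ P ∪ A ∩ B, G.Adj v y →
      y ∈ U ∪ outerNeighbors G (P ∪ A ∩ B) U) :
    ∃ A' B', IsBigSep G K W A' B' ∧ (A' ∩ B').card = (outerNeighbors G (P ∪ A ∩ B) U).card ∧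
      B'.card + U.card ≤ B.card + P.card := by
  obtain ⟨⟨hcov, hAB⟩, -, hbig⟩ := h
  have hcov' : ∀ x, x ∈ A ∨ x ∈ B := fun x ↦ by
    rw [← mem_union, hcov]
    exact mem_univ x
  set S := outerNeighbors G (P ∪ A ∩ B) U with hS
  have hS' : ∀ v, v ∈ S → v ∈ P ∪ A ∩ B ∧ v ∉ U := fun v hv ↦
    ⟨(mem_outerNeighbors.1 hv).1, (mem_outerNeighbors.1 hv).2.1⟩
  have hUS : ∀ u ∈ U, ∀ v ∈ P ∪ A ∩ B, v ∉ U → G.Adj u v → v ∈ S := fun u hu v hv hvU huv ↦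
    mem_outerNeighbors.2 ⟨hv, hvU, u, hu, huv⟩
  clear_value S
  have hint : (univ \ (B ∪ P \ U) ∪ S) ∩ (B ∪ P \ U) = S := by
    clear hadj hUS hAB
    ext x
    have := hS' x
    simp only [mem_inter, mem_union, mem_sdiff, mem_univ, true_and] at this ⊢
    tauto
  refine ⟨univ \ (B ∪ P \ U) ∪ S, B ∪ P \ U, ⟨⟨?_, ?_⟩, by rwa [hint], ?_⟩, by rw [hint], ?_⟩
  · ext x
    simp only [mem_union, mem_sdiff, mem_univ, true_and]
    tauto
  · intro u hu v hv huv
    simp only [mem_sdiff, mem_union, mem_univ, true_and, not_or, not_and, not_not] at hu hv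
    have huB := hu.2.1
    have huA := (hcov' u).resolve_right huB
    have hvS := hv.2.2
    have hvY : v ∈ P ∪ A ∩ B := by
      by_contra hvY
      rw [mem_union, mem_inter] at hvY
      have hvB : v ∈ B := hv.1.resolve_right fun h ↦ hvY (.inl h.1)
      exact hAB u (mem_sdiff.2 ⟨huA, huB⟩) v (mem_sdiff.2 ⟨hvB, fun h ↦ hvY (.inr ⟨h, hvB⟩)⟩) huv
    have hvU : v ∉ U := fun h ↦ hv.1.elim (mem_sdiff.1 (hP (hU h))).2 fun h' ↦ h'.2 h
    by_cases huU : u ∈ U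
    · exact hvS (hUS u huU v hvY hvU huv)
    · have huP : u ∉ P := fun h ↦ huU (hu.2.2 h)
      exact (mem_union.1 (hadj u (mem_sdiff.2 ⟨mem_sdiff.2 ⟨huA, huB⟩, huP⟩) v hvY huv)).elim
        hvU hvS
  · refine hbig.trans_le (Nat.mul_le_mul_left _ (card_le_card ?_))
    intro x
    have := hS' x
    have := @hP x
    simp only [mem_inter, mem_union, mem_sdiff, mem_univ, true_and] at *
    tauto
  · have := card_union_le B (P \ U)
    have := card_sdiff_add_card_eq_card hU
    omega

theorem exists_balanced_split {G : SimpleGraph V} {a : ℕ}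
    (hsep : ∀ H : G.Subgraph, ∃ A B : Finset V, BalancedSepOf H A B ∧ (A ∩ B).card ≤ a)
    (Y : Finset V) : ∃ C D, C ∪ D = Y ∧ (∀ u ∈ C \ D, ∀ v ∈ D \ C, ¬ G.Adj u v) ∧
      3 * (C \ D).card ≤ 2 * Y.card ∧ 3 * (D \ C).card ≤ 2 * Y.card ∧ (C ∩ D).card ≤ a := by
  obtain ⟨C, D, ⟨⟨hcov, hadj⟩, hC, hD⟩, hcard⟩ := hsep ((⊤ : G.Subgraph).induce Y)
  rw [SimpleGraph.Subgraph.induce_verts, Set.ncard_coe_finset] at hC hD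
  rw [SimpleGraph.Subgraph.induce_verts, ← coe_union, coe_inj] at hcov
  refine ⟨C, D, hcov, fun u hu v hv huv ↦ hadj u v ?_ ⟨hu, hv⟩, hC, hD, hcard⟩
  simp only [SimpleGraph.Subgraph.induce_adj, SimpleGraph.Subgraph.top_adj, mem_coe, ← hcov]
  exact ⟨mem_union_left _ (mem_sdiff.1 hu).1, mem_union_right _ (mem_sdiff.1 hv).1, huv⟩

theorem potential_lt_of_balanced {a x h x' h' : ℕ} (ha : 1 ≤ a) (hh : 52 * a ≤ h)
    (hh' : 3 * h' ≤ 2 * h + 3 * a) (hx' : x' ≤ x + a) :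
    h' * (7 * a + 3 * x') < h * (7 * a + 3 * x) := by
  have h₁ : h' * (7 * a + 3 * x') ≤ h' * (10 * a + 3 * x) := Nat.mul_le_mul_left _ (by omega)
  have h₂ := Nat.mul_le_mul_right (10 * a + 3 * x) hh'
  have h₃ := Nat.mul_le_mul_right (a + 3 * x) hh
  nlinarith

theorem potential_lt_of_tight {a r x h b c : ℕ} (ha : 1 ≤ a) (hh : 52 * a ≤ h)
    (hr : 3 * (r * a) ≤ h) (hr' : h ≤ 3 * (r * a) + 3 * a) (hx : 25 * a ≤ x)
    (hb : b + r * c ≤ h + (2 * h + 6 * (r * a) + 3 * a)) :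
    b * (7 * a + 3 * c) < h * (7 * a + 3 * x) := by
  have h₁ : h * (82 * a) ≤ h * (7 * a + 3 * x) := Nat.mul_le_mul_left _ (by omega)
  refine lt_of_lt_of_le ?_ h₁
  zify at *
  generalize (a : ℤ) = a, (r : ℤ) = r, (h : ℤ) = h, (b : ℤ) = b at *
  have hc : (0 : ℤ) ≤ c := Int.natCast_nonneg c
  generalize (c : ℤ) = c at *
  refine lt_of_mul_lt_mul_left (a := a) ?_ (by omega)
  have e₁ : b * (7 * a + 3 * c) ≤ (5 * h + 3 * a - r * c) * (7 * a + 3 * c) :=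
    mul_le_mul_of_nonneg_right (by linarith) (by linarith)
  have e₂ : a * (b * (7 * a + 3 * c)) ≤ a * ((5 * h + 3 * a - r * c) * (7 * a + 3 * c)) :=
    mul_le_mul_of_nonneg_left e₁ (by omega)
  have e₃ := mul_le_mul_of_nonneg_right hr' (mul_self_nonneg c)
  have e₄ := mul_le_mul_of_nonneg_right hh (mul_self_nonneg c)
  have e₅ := mul_le_mul_of_nonneg_right hh (mul_self_nonneg a)
  have e₆ := mul_le_mul_of_nonneg_right hh (mul_nonneg (by omega : 0 ≤ a) hc)
  have e₇ := mul_le_mul_of_nonneg_right hr' (mul_nonneg (by omega : 0 ≤ a) hc)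
  have hh₀ : 0 < h := by omega
  have e₈ := mul_nonneg hh₀.le (sq_nonneg (c - 7 * a))
  have e₉ : 0 ≤ h * (a * c) := by positivity
  have e₁₀ : 0 < h * (a * a) := by positivity
  nlinarith

theorem not_isWellLinked {G : SimpleGraph V} {a : ℕ} (ha : 1 ≤ a)
    (hsep : ∀ H : G.Subgraph, ∃ A B : Finset V, BalancedSepOf H A B ∧ (A ∩ B).card ≤ a)
    {W : Finset V} (hWcard : W.card = 78 * a + 1) : ¬ IsWellLinked G (26 * a) W := by
  intro hW
  classical
  -- a big separation minimizing the potential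
  let big : Finset (Finset V × Finset V) := {p | IsBigSep G (26 * a) W p.1 p.2}
  have hne : big.Nonempty := by
    refine ⟨(∅, univ), ?_⟩
    simp [big, IsBigSep, IsSep]
    omega
  obtain ⟨⟨A, B⟩, hAB, hmin⟩ :=
    exists_min_image big (fun p ↦ p.2.card * (7 * a + 3 * (p.1 ∩ p.2).card)) hne
  replace hmin : ∀ A' B', IsBigSep G (26 * a) W A' B' →
      B.card * (7 * a + 3 * (A ∩ B).card) ≤ B'.card * (7 * a + 3 * (A' ∩ B').card) :=
    fun A' B' h ↦ hmin (A', B') (by simpa [big] using h)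
  replace hAB : IsBigSep G (26 * a) W A B := by simpa [big] using hAB
  set X := A ∩ B with hX
  set h := B.card with hh
  have hXB : X ⊆ B := inter_subset_right
  have hhlow : 52 * a + 1 ≤ h := by
    have h₁ : (W ∩ (B \ A)).card ≤ h := card_le_card (inter_subset_right.trans sdiff_subset)
    have h₂ := hAB.2.2
    omega
  -- the separator is large
  have hXlow : 25 * a + 1 ≤ X.card := by
    by_contra! hlt
    obtain ⟨C, D, hCD, hadj, hC, hD, hs⟩ := exists_balanced_split hsep B
    have hC' := card_sdiff_add_card_inter C D
    have hD' := card_sdiff_add_card_inter D C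
    rw [inter_comm D C] at hD'
    have ho₁ : ((A ∪ C) ∩ D).card ≤ X.card + a := by
      have : (A ∪ C) ∩ D ⊆ X ∪ C ∩ D := by
        rw [hX, ← hCD]
        clear * -
        grind
      exact (card_le_card this).trans ((card_union_le _ _).trans (by omega))
    have ho₂ : ((A ∪ D) ∩ C).card ≤ X.card + a := by
      have : (A ∪ D) ∩ C ⊆ X ∪ C ∩ D := by
        rw [hX, ← hCD]
        clear * -
        grind
      exact (card_le_card this).trans ((card_union_le _ _).trans (by omega))
    rcases hAB.split hW hCD hadj (by omega) (by omega) with h' | h'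
    · exact (hmin _ _ h').not_gt (potential_lt_of_balanced ha (by omega) (by omega) ho₁)
    · exact (hmin _ _ h').not_gt (potential_lt_of_balanced ha (by omega) (by omega) ho₂)
  let r := h / (3 * a)
  have hr₁ : 3 * (r * a) ≤ h := by
    have := Nat.div_mul_le_self h (3 * a)
    simp only [r]
    linarith
  have hr₂ : h < 3 * (r * a) + 3 * a := by
    have := Nat.lt_div_mul_add (a := h) (b := 3 * a) (by omega)
    simp only [r]
    linarith
  have hr : 17 ≤ r := (Nat.le_div_iff_mul_le (by omega)).2 (by omega)
  clear_value r
  let N := 2 * h + 6 * (r * a) + 3 * a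
  -- a maximal expanding set on the small side
  let good : Finset (Finset V) := {P | P ⊆ A \ B ∧ Expands G r X P ∧ P.card ≤ N}
  have hgood : ∀ P, P ∈ good ↔ P ⊆ A \ B ∧ Expands G r X P ∧ P.card ≤ N := by simp [good]
  obtain ⟨P, hPgood, hPmax⟩ := exists_max_image good card ⟨∅, (hgood _).2 ⟨empty_subset _,
    fun U hU ↦ by simp [subset_empty.1 hU], by simp⟩⟩
  obtain ⟨hPA, hP, hPN⟩ := (hgood P).1 hPgood
  rcases hPN.lt_or_eq with hlt | heq
  · obtain ⟨U, hUP, hU, hadj⟩ := hP.exists_tight (M := A \ B) (by omega)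
      (disjoint_left.2 fun v hv hvX ↦ (mem_sdiff.1 hv).2 (hXB hvX)) (by
        intro v hv hexp
        have hvP := (mem_sdiff.1 hv).2
        have := hPmax (insert v P) ((hgood _).2 ⟨insert_subset (mem_sdiff.1 hv).1 hPA, hexp, by
          rw [card_insert_of_notMem hvP]
          omega⟩)
        rw [card_insert_of_notMem hvP] at this
        omega)
    have hUcard := card_le_card hUP
    have hc : (outerNeighbors G (P ∪ X) U).card < 13 * a := by
      by_contra! hge
      have := Nat.mul_le_mul_left r hge
      have : 17 * a ≤ r * a := Nat.mul_le_mul_right a hr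
      have : r * (13 * a) = 13 * (r * a) := by ring
      omega
    obtain ⟨A', B', hbig, hord, hB'⟩ := hAB.of_tight hPA hUP
      (hc.le.trans (Nat.mul_le_mul_right a (by omega))) hadj
    rw [← hX] at hord
    refine (hmin _ _ hbig).not_gt ?_
    rw [hord]
    exact potential_lt_of_tight ha (by omega) hr₁ hr₂.le (by omega) (by omega)
  · have hPB : Disjoint B P := disjoint_left.2 fun v hv hvP ↦ (mem_sdiff.1 (hPA hvP)).2 hv
    have hcard : (B ∪ P).card = h + N := by rw [card_union_of_disjoint hPB, heq]
    obtain ⟨C, D, hCD, hadj, hC, hD, hs⟩ := exists_balanced_split hsep (B ∪ P)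
    -- both sides meet the separator in at least `a` vertices
    have hlarge : ∀ C D, C ∪ D = B ∪ P → (∀ u ∈ C \ D, ∀ v ∈ D \ C, ¬ G.Adj u v) →
        3 * (D \ C).card ≤ 2 * (B ∪ P).card → (C ∩ D).card ≤ a → a ≤ (X ∩ (C \ D)).card := by
      intro C D hCD hadj hD hs
      have h₁ := hP (P ∩ (C \ D)) inter_subset_left
      have h₂ : outerNeighbors G (P ∪ X) (P ∩ (C \ D)) ⊆ C ∩ D ∪ X ∩ (C \ D) := by
        intro y hy
        obtain ⟨hyY, hyU, u, hu, huy⟩ := mem_outerNeighbors.1 hy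
        have h₃ : y ∈ C ∪ D := by
          rw [hCD]
          have := @hXB y
          grind
        have h₄ := fun h ↦ hadj u (mem_inter.1 hu).2 y h huy
        clear * - hyY hyU h₃ h₄
        grind
      have h₃ := (card_le_card h₂).trans (card_union_le _ _)
      have h₄ : (B ∪ P).card ≤ (D \ C).card + (C ∩ D).card + (B.card + (P ∩ (C \ D)).card) := by
        have : B ∪ P ⊆ (D \ C) ∪ (C ∩ D) ∪ (B ∪ P ∩ (C \ D)) := by
          rw [← hCD]
          intro x hx
          have : x ∈ B ∪ P := hCD ▸ hx
          clear * - hx this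
          grind
        exact (card_le_card this).trans ((card_union_le _ _).trans
          (add_le_add (card_union_le _ _) (card_union_le _ _)))
      have h₅ : 2 * a ≤ (C ∩ D).card + (X ∩ (C \ D)).card := by
        refine le_trans ?_ h₃
        refine Nat.le_of_mul_le_mul_left ?_ (by omega : 0 < r)
        refine le_trans ?_ h₁
        have : r * (2 * a) = 2 * (r * a) := by ring
        omega
      omega
    -- restricting the separation to `B` contradicts minimality
    have hrestrict : ∀ C D, C ∪ D = B ∪ P → (C ∩ D).card ≤ a → a ≤ (X ∩ (C \ D)).card →
        ((A ∪ C ∩ B) ∩ (D ∩ B)).card ≤ X.card ∧ (D ∩ B).card < h := by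
      intro C D hCD hs hXC
      constructor
      · have h₁ : (A ∪ C ∩ B) ∩ (D ∩ B) ⊆ X ∩ D ∪ C ∩ D := by
          rw [hX]
          clear * -
          grind
        have h₂ : X ∩ D ⊆ X \ (X ∩ (C \ D)) := by
          clear * -
          grind
        have h₃ := (card_le_card h₁).trans (card_union_le _ _)
        have h₄ := card_le_card h₂
        have h₅ := card_sdiff_add_card_eq_card (inter_subset_left : X ∩ (C \ D) ⊆ X)
        omega
      · obtain ⟨x, hx⟩ := card_pos.1 (show 0 < (X ∩ (C \ D)).card by omega)
        refine card_lt_card (Finset.ssubset_iff_subset_ne.2 ⟨inter_subset_right, fun h ↦ ?_⟩)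
        have hxB := hXB (mem_inter.1 hx).1
        rw [← h] at hxB
        exact (mem_sdiff.1 (mem_inter.1 hx).2).2 (mem_inter.1 hxB).1
    have hcontra : ∀ A' B', IsBigSep G (26 * a) W A' B' → (A' ∩ B').card ≤ X.card →
        ¬ B'.card < h := by
      intro A' B' hbig hle hlt
      refine (hmin _ _ hbig).not_gt ?_
      calc B'.card * (7 * a + 3 * (A' ∩ B').card) ≤ B'.card * (7 * a + 3 * X.card) :=
            Nat.mul_le_mul_left _ (by omega)
        _ < h * (7 * a + 3 * X.card) := Nat.mul_lt_mul_of_pos_right hlt (by omega)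
    have hCr := hrestrict C D hCD hs (hlarge C D hCD hadj hD hs)
    have hCD' : D ∪ C = B ∪ P := by rwa [union_comm]
    have hs' : (D ∩ C).card ≤ a := by rwa [inter_comm]
    have hDr := hrestrict D C hCD' hs'
      (hlarge D C hCD' (fun u hu v hv huv ↦ hadj v hv u hu huv.symm) hC hs')
    have hXK := hAB.2.1
    have hcov : C ∩ B ∪ D ∩ B = B := by
      rw [← union_inter_distrib_right, hCD]
      exact inter_eq_right.2 subset_union_left
    have hadj' : ∀ u ∈ (C ∩ B) \ (D ∩ B), ∀ v ∈ (D ∩ B) \ (C ∩ B), ¬ G.Adj u v := by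
      intro u hu v hv
      refine hadj u ?_ v ?_
      · clear * - hu
        grind
      · clear * - hv
        grind
    rcases hAB.split hW hcov hadj' (hCr.1.trans hXK) (hDr.1.trans hXK) with h' | h'
    · exact hcontra _ _ h' hCr.1 hCr.2
    · exact hcontra _ _ h' hDr.1 hDr.2

theorem HasTDWidthLE.of_forall_exists_balancedSepOf {G : SimpleGraph V} {a : ℕ} (ha : 1 ≤ a)
    (hsep : ∀ H : G.Subgraph, ∃ A B : Finset V, BalancedSepOf H A B ∧ (A ∩ B).card ≤ a) :
    HasTDWidthLE G (4 * (26 * a)) := by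
  refine HasRootedTDWidthLE.hasTDWidthLE (Z := ∅)
    (HasRootedTDWidthLE.of_balanced (fun W hW ↦ ?_) _ _ (empty_subset _) (by simp))
  have h := not_isWellLinked ha hsep (W := W) (by omega)
  simpa [IsWellLinked, and_assoc] using h

/-- The treewidth and the separation number are linearly tied:
`sn(G) - 1 ≤ tw(G) ≤ 105 sn(G)`. -/
theorem sepNum_treewidth_tied (G : SimpleGraph V) :
    sepNum G - 1 ≤ treewidth G ∧ treewidth G ≤ 105 * sepNum G := by
  have hcardV : HasTDWidthLE G (Fintype.card V) :=
    HasRootedTDWidthLE.hasTDWidthLE (Z := ∅)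
      (.of_card_le G (by simp) (empty_subset _))
  have htw : HasTDWidthLE G (treewidth G) :=
    Nat.sInf_mem (s := {w | HasTDWidthLE G w}) ⟨_, hcardV⟩
  have hsn : ∀ H : G.Subgraph, ∃ A B : Finset V, BalancedSepOf H A B ∧
      (A ∩ B).card ≤ sepNum G :=
    Nat.sInf_mem (s := {s | ∀ H : G.Subgraph, ∃ A B : Finset V, BalancedSepOf H A B ∧
      (A ∩ B).card ≤ s}) ⟨_, fun H ↦ htw.exists_balancedSepOf H⟩
  constructor
  · have : sepNum G ≤ treewidth G + 1 := Nat.sInf_le fun H ↦ htw.exists_balancedSepOf H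
    omega
  · rcases Nat.eq_zero_or_pos (sepNum G) with h₀ | hpos
    · have hV : Fintype.card V = 0 := by
        rw [Fintype.card_eq_zero_iff]
        refine ⟨fun v ↦ ?_⟩
        obtain ⟨A, B, ⟨⟨hcov, -⟩, hA, hB⟩, hs⟩ := hsn (G.singletonSubgraph v)
        rw [h₀] at hs
        simp only [SimpleGraph.singletonSubgraph_verts, Set.ncard_singleton] at hcov hA hB
        rw [← coe_union, ← coe_singleton, coe_inj] at hcov
        have h₁ := card_union_add_card_inter A B
        have h₂ := card_sdiff_add_card_inter A B
        have h₃ := card_sdiff_add_card_inter B A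
        rw [inter_comm B A] at h₃
        rw [hcov, card_singleton] at h₁
        omega
      have : treewidth G ≤ 0 := Nat.sInf_le (hV ▸ hcardV)
      omega
    · have : treewidth G ≤ 4 * (26 * sepNum G) :=
        Nat.sInf_le (HasTDWidthLE.of_forall_exists_balancedSepOf hpos hsn)
      omega
end
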